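/- arXiv:2112.00191 — 2 statements merged into one kernel-verified Lean document; each statement's English description precedes it below -/
import Mathlib

section
/- Let α ∈ (0,1/2) and γ ∈ [2α, 1]. Suppose ω = χ_{Ω(t)} (a single patch with θ = 1) is a patch solution to the g-SQG equation on ℝ² on [0,T) with T < ∞, with constant-speed parameterizations z(·,t) of ∂Ω(t), and M := sup_{t∈[0,T)} ‖z(·,t)‖_{C^{1,γ}} < ∞ and M' := inf_{(ξ,t)} |∂_ξ z(ξ,t)| > 0. Set δ := (M'/(4M))^{1/γ} and m(t) := min_{|ξ−η| ≥ δ} |z(ξ,t) − z(η,t)|. Assume in addition that only simple splashes can happen: there exist R > 0 and t₀ ∈ [0,T) such that for all t ∈ [t₀,T), any pair (ξ_t,η_t) attaining m(t), and any ξ ∈ 𝕋 with min(|ξ−ξ_t|, |ξ−η_t|) ≥ δ, one has |z(ξ,t) − z(η_t,t)| > R. Then inf_{t∈[0,T)} m(t) > 0; i.e., no simple splash (touch of exactly two boundary segments) can occur at time T. -/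
open Real Set Filter MeasureTheory

noncomputable section

abbrev R2 : Type := EuclideanSpace ℝ (Fin 2)

def mk2 (a b : ℝ) : R2 := (EuclideanSpace.equiv (Fin 2) ℝ).symm ![a, b]

/-- Counterclockwise rotation by 90°: `(v₁,v₂)^⊥ = (−v₂,v₁)`. -/
def perp (v : R2) : R2 := mk2 (-(v 1)) (v 0)

/-- The g-SQG Biot–Savart kernel `w ↦ w^⊥/|w|^{2+2α}`. -/
def kern (α : ℝ) (w : R2) : R2 := (‖w‖ ^ (2 + 2 * α))⁻¹ • perp w

/-- The g-SQG velocity of a single patch `ω = χ_Ω`: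
`u(x) = c_α ∫_Ω (x−y)^⊥/|x−y|^{2+2α} dy`. -/
def gSQGvel (α cα : ℝ) (Ω : Set R2) (x : R2) : R2 :=
  cα • ∫ y in Ω, kern α (x - y)

/-- The distance on the torus `𝕋 = ℝ/2πℤ` between (the classes of) two reals. -/
def distT (ξ η : ℝ) : ℝ := ⨅ k : ℤ, |ξ - η + 2 * π * k|


lemma distT_eq (ξ η : ℝ) : distT ξ η = ‖((ξ - η : ℝ) : AddCircle (2 * π))‖ := by
  unfold distT
  apply le_antisymm
  · rw [AddCircle.norm_eq]
    refine (ciInf_le ⟨0, ?_⟩ (-round ((2 * π)⁻¹ * (ξ - η)))).trans (le_of_eq ?_)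
    · rintro _ ⟨k, rfl⟩; positivity
    · congr 1; push_cast; ring
  · refine le_ciInf fun k => ?_
    have h : ((ξ - η : ℝ) : AddCircle (2 * π)) = ((ξ - η + 2 * π * k : ℝ) : AddCircle (2 * π)) := by
      rw [AddCircle.coe_add]
      have : ((2 * π * k : ℝ) : AddCircle (2 * π)) = 0 := by
        rw [AddCircle.coe_eq_zero_iff]
        exact ⟨k, by simp; ring⟩
      rw [this, add_zero]
    rw [h]
    have := QuotientAddGroup.norm_mk_le_norm (S := AddSubgroup.zmultiples (2 * π)) (m := (ξ - η + 2 * π * k))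
    simpa using this

lemma distT_le (ξ η : ℝ) (k : ℤ) : distT ξ η ≤ |ξ - η + 2 * π * k| := by
  unfold distT
  exact ciInf_le ⟨0, by rintro _ ⟨k, rfl⟩; positivity⟩ k

lemma distT_le_abs (ξ η : ℝ) : distT ξ η ≤ |ξ - η| := by
  simpa using distT_le ξ η 0

lemma distT_exists (ξ η : ℝ) : ∃ k : ℤ, distT ξ η = |ξ - η + 2 * π * k| := by
  rw [distT_eq, AddCircle.norm_eq]
  refine ⟨-round ((2 * π)⁻¹ * (ξ - η)), ?_⟩
  congr 1; push_cast; ring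

lemma distT_neg (ξ η a κ : ℝ) (hκ : κ = 1 ∨ κ = -1) :
    distT (a + κ * ξ) (a + κ * η) = distT ξ η := by
  rw [distT_eq, distT_eq]
  rcases hκ with rfl | rfl
  · congr 2; ring
  · rw [show a + -1 * ξ - (a + -1 * η) = -(ξ - η) by ring, AddCircle.coe_neg, norm_neg]

lemma distT_comm (ξ η : ℝ) : distT ξ η = distT η ξ := by
  rw [distT_eq, distT_eq, show ξ - η = -(η - ξ) by ring, AddCircle.coe_neg, norm_neg]

lemma distT_shift (ξ η : ℝ) (k l : ℤ) :
    distT (ξ + 2 * π * k) (η + 2 * π * l) = distT ξ η := by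
  rw [distT_eq, distT_eq,
    show ξ + 2 * π * k - (η + 2 * π * l) = (ξ - η) + (k - l : ℤ) • (2 * π) by
      push_cast [zsmul_eq_mul]; ring, AddCircle.coe_add]
  have : (((k - l : ℤ) • (2 * π) : ℝ) : AddCircle (2 * π)) = 0 := by
    rw [AddCircle.coe_eq_zero_iff]; exact ⟨_, rfl⟩
  rw [this, add_zero]

lemma distT_le_pi (ξ η : ℝ) : distT ξ η ≤ π := by
  rw [distT_eq]
  have := AddCircle.norm_le_half_period (2 * π) (x := ((ξ - η : ℝ) : AddCircle (2 * π)))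
    (by positivity)
  rw [abs_of_pos (by positivity)] at this
  linarith

lemma distT_pi : distT π 0 = π := by
  rw [distT_eq, sub_zero]
  have := (AddCircle.norm_coe_eq_abs_iff (2 * π) (x := π) (by positivity)).2
    (by rw [abs_of_pos (by positivity), abs_of_pos (by positivity)]; linarith)
  rw [this, abs_of_pos (by positivity)]

lemma distT_cont : Continuous (fun p : ℝ × ℝ => distT p.1 p.2) := by
  simp_rw [distT_eq]
  exact ((AddCircle.continuous_mk' (2 * π)).comp (by fun_prop)).norm

lemma distT_lip (ξ η ξ' η' : ℝ) : |distT ξ η - distT ξ' η'| ≤ |ξ - ξ'| + |η - η'| := by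
  rw [distT_eq, distT_eq]
  refine (abs_norm_sub_norm_le _ _).trans ?_
  rw [← AddCircle.coe_sub]
  have := QuotientAddGroup.norm_mk_le_norm (S := AddSubgroup.zmultiples (2 * π)) (m := (ξ - η - (ξ' - η')))
  refine (le_trans this ?_)
  rw [Real.norm_eq_abs, show ξ - η - (ξ' - η') = (ξ - ξ') - (η - η') by ring]
  exact abs_sub _ _

/-- A good curve: periodic, simple, of constant speed and with `C^{1,γ}` bounds. -/
structure GC (γ M M' : ℝ) (f : ℝ → R2) : Prop where
  per : ∀ ξ, f (ξ + 2 * π) = f ξ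
  inj : InjOn f (Ico 0 (2 * π))
  C1 : ContDiff ℝ 1 f
  speed : ∃ c : ℝ, 0 < c ∧ ∀ ξ, ‖deriv f ξ‖ = c
  bd : ∀ ξ, ‖f ξ‖ ≤ M
  dbd : ∀ ξ, ‖deriv f ξ‖ ≤ M
  hol : ∀ ξ η, ‖deriv f ξ - deriv f η‖ ≤ M * |ξ - η| ^ γ
  low : ∀ ξ, M' ≤ ‖deriv f ξ‖

namespace GC

variable {γ M M' : ℝ} {f : ℝ → R2}

lemma perz (h : GC γ M M' f) (ξ : ℝ) (k : ℤ) : f (ξ + 2 * π * k) = f ξ := by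
  have hp : Function.Periodic f (2 * π) := h.per
  have := hp.int_mul k ξ
  rw [mul_comm (2 * π)]; simpa using this

lemma cont (h : GC γ M M' f) : Continuous f := h.C1.continuous

lemma hasDeriv (h : GC γ M M' f) (ξ : ℝ) : HasDerivAt f (deriv f ξ) ξ :=
  (h.C1.differentiable (by norm_num) ξ).hasDerivAt

lemma injz (h : GC γ M M' f) {ξ η : ℝ} (he : f ξ = f η) : ∃ k : ℤ, ξ = η + 2 * π * k := by
  have h2 : (0 : ℝ) < 2 * π := by positivity
  have e1 := h.perz (toIcoMod h2 0 ξ) (toIcoDiv h2 0 ξ)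
  have e2 := h.perz (toIcoMod h2 0 η) (toIcoDiv h2 0 η)
  have t1 := toIcoMod_add_toIcoDiv_zsmul h2 0 ξ
  have t2 := toIcoMod_add_toIcoDiv_zsmul h2 0 η
  rw [zsmul_eq_mul, mul_comm (Int.cast _) _] at t1 t2
  rw [t1] at e1
  rw [t2] at e2
  have m1 := toIcoMod_mem_Ico h2 0 ξ
  have m2 := toIcoMod_mem_Ico h2 0 η
  rw [zero_add] at m1 m2
  have := h.inj m1 m2 (by rw [← e1, ← e2, he])
  refine ⟨toIcoDiv h2 0 ξ - toIcoDiv h2 0 η, ?_⟩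
  push_cast
  linarith

lemma lip (h : GC γ M M' f) (ξ η : ℝ) : ‖f ξ - f η‖ ≤ M * |ξ - η| := by
  have := convex_univ.norm_image_sub_le_of_norm_deriv_le (f := f) (C := M) (x := η) (y := ξ)
    (fun x _ => (h.hasDeriv x).differentiableAt) (fun x _ => h.dbd x) (mem_univ _) (mem_univ _)
  simpa using this

lemma taylor (h : GC γ M M' f) (hγ : 0 ≤ γ) (hM : 0 ≤ M) (ξ η ζ : ℝ) (r : ℝ)
    (h1 : |ξ - ζ| ≤ r) (h2 : |η - ζ| ≤ r) :
    ‖f η - f ξ - (η - ξ) • deriv f ζ‖ ≤ M * r ^ γ * |η - ξ| := by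
  have hd : ∀ x, HasDerivAt (fun x => f x - x • deriv f ζ) (deriv f x - deriv f ζ) x := by
    intro x
    have := (h.hasDeriv x).sub ((hasDerivAt_id x).smul_const (deriv f ζ))
    rw [one_smul] at this
    exact this
  have hc : Convex ℝ (Icc (ζ - r) (ζ + r)) := convex_Icc _ _
  have := hc.norm_image_sub_le_of_norm_hasDerivWithin_le
    (f := fun x => f x - x • deriv f ζ) (C := M * r ^ γ) (x := ξ) (y := η)
    (fun x _ => (hd x).hasDerivWithinAt) (fun x hx => by
      refine (h.hol x ζ).trans ?_
      have : |x - ζ| ≤ r := by rw [abs_le]; constructor <;> linarith [hx.1, hx.2]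
      gcongr)
    (by rw [abs_le] at h1; constructor <;> linarith)
    (by rw [abs_le] at h2; constructor <;> linarith)
  rw [Real.norm_eq_abs] at this
  have e : f η - f ξ - (η - ξ) • deriv f ζ = f η - η • deriv f ζ - (f ξ - ξ • deriv f ζ) := by
    rw [sub_smul]; abel
  rw [e]; exact this

lemma taylor' (h : GC γ M M' f) (hγ : 0 ≤ γ) (hM : 0 ≤ M) (ξ η : ℝ) :
    ‖f η - f ξ - (η - ξ) • deriv f ξ‖ ≤ M * |η - ξ| ^ γ * |η - ξ| :=
  h.taylor hγ hM ξ η ξ _ (by simp) le_rfl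

end GC



open scoped Topology

lemma GC.near {γ M M' : ℝ} {f : ℝ → R2} (h : GC γ M M' f) {w : ℝ → R2} (hw : Continuous w)
    (hr : ∀ ξ, ∃ ζ, w ξ = f ζ) (ξ₀ ζ₀ : ℝ) (h0 : w ξ₀ = f ζ₀) (ρ : ℝ) (hρ : 0 < ρ) :
    ∀ᶠ ξ in 𝓝 ξ₀, ∃ ζ, |ζ - ζ₀| < ρ ∧ w ξ = f ζ := by
  have hK : IsCompact (Icc (ζ₀ - π) (ζ₀ + π) ∩ {ζ | ρ ≤ |ζ - ζ₀|}) :=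
    isCompact_Icc.inter_right (isClosed_le (by fun_prop) (by fun_prop))
  have hcl := (hK.image h.cont).isClosed
  have hn : w ξ₀ ∉ f '' (Icc (ζ₀ - π) (ζ₀ + π) ∩ {ζ | ρ ≤ |ζ - ζ₀|}) := by
    rintro ⟨ζ, ⟨hζ1, hζ2⟩, he⟩
    rw [h0] at he
    obtain ⟨k, hk⟩ := h.injz he
    simp only [mem_ofPred_eq] at hζ2
    have h3 : |ζ - ζ₀| ≤ π := by rw [abs_le]; constructor <;> linarith [hζ1.1, hζ1.2]
    rw [hk, add_sub_cancel_left, abs_mul, abs_of_pos (by positivity : (0:ℝ) < 2 * π)] at hζ2 h3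
    have hpi := Real.pi_pos
    have h4 : |(k : ℝ)| < 1 := by
      by_contra hc
      push Not at hc
      nlinarith
    have h5 : k = 0 := by
      rw [← Int.abs_lt_one_iff]; exact_mod_cast h4
    rw [h5] at hζ2; simp at hζ2; linarith
  have := hw.continuousAt.eventually (hcl.isOpen_compl.mem_nhds hn)
  filter_upwards [this] with ξ hξ
  obtain ⟨ζ, hζ⟩ := hr ξ
  obtain ⟨k, hk⟩ := distT_exists ζ ζ₀
  have hp := distT_le_pi ζ ζ₀
  rw [hk, abs_le] at hp
  refine ⟨ζ + 2 * π * k, ?_, by rw [h.perz, hζ]⟩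
  by_contra hc
  push Not at hc
  apply hξ
  exact ⟨ζ + 2 * π * k, ⟨⟨by linarith, by linarith⟩, hc⟩, by rw [h.perz, hζ]⟩

lemma GC.lift_local {γ M M' : ℝ} {f : ℝ → R2} (h : GC γ M M' f) {w v : ℝ → R2}
    (hw : ∀ ξ, HasDerivAt w (v ξ) ξ) (hv : Continuous v) {c cs : ℝ} (hc : 0 < c) (hcs : 0 < cs)
    (hvc : ∀ ξ, ‖v ξ‖ = c) (hfc : ∀ ξ, ‖deriv f ξ‖ = cs)
    (hr : ∀ ξ, ∃ ζ, w ξ = f ζ) (ξ₀ ζ₀ : ℝ) (h0 : w ξ₀ = f ζ₀) :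
    ∃ κ, |κ| = c / cs ∧ ∀ᶠ ξ in 𝓝 ξ₀, w ξ = f (ζ₀ + κ * (ξ - ξ₀)) := by
  have hwd : deriv w = v := funext fun ξ => (hw ξ).deriv
  have hwC : ContDiff ℝ 1 w := by
    rw [contDiff_one_iff_deriv]
    exact ⟨fun ξ => (hw ξ).differentiableAt, by rw [hwd]; exact hv⟩
  set e := deriv f ζ₀ with he
  have hee : inner ℝ e e = cs ^ 2 := by rw [real_inner_self_eq_norm_sq, hfc]
  let p : ℝ → ℝ := fun ζ => inner ℝ e (f ζ - f ζ₀)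
  have hpC : ContDiff ℝ 1 p := contDiff_const.inner ℝ (h.C1.sub contDiff_const)
  have hpd : HasDerivAt p (cs ^ 2) ζ₀ := by
    have := (hasDerivAt_const ζ₀ e).inner ℝ ((h.hasDeriv ζ₀).sub_const (f ζ₀))
    rw [inner_zero_left, add_zero, ← he, hee] at this
    exact this
  have hne : cs ^ 2 ≠ 0 := by positivity
  let L : ℝ ≃L[ℝ] ℝ := ContinuousLinearEquiv.unitsEquivAut ℝ (Units.mk0 _ hne)
  have hL : HasFDerivAt p (L : ℝ →L[ℝ] ℝ) ζ₀ := by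
    exact hpd.hasFDerivAt_equiv hne
  have hpA : ContDiffAt ℝ 1 p ζ₀ := hpC.contDiffAt
  have hqC := hpA.to_localInverse hL (by norm_num)
  have hql := (hpA.hasStrictFDerivAt' hL (by norm_num)).eventually_left_inverse
  set q := hpA.localInverse hL (by norm_num) with hq
  have hql' : ∀ᶠ x in 𝓝 ζ₀, q (p x) = x := hql
  obtain ⟨ρ, hρ, hql2⟩ := Metric.eventually_nhds_iff.1 hql'
  let ψ : ℝ → ℝ := fun ξ => q (inner ℝ e (w ξ - f ζ₀))
  have hψC : ContDiffAt ℝ 1 ψ ξ₀ := by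
    have h1 : ContDiff ℝ 1 (fun ξ => inner ℝ e (w ξ - f ζ₀)) :=
      contDiff_const.inner ℝ (hwC.sub contDiff_const)
    have h2 : p ζ₀ = inner ℝ e (w ξ₀ - f ζ₀) := by simp [p, h0]
    rw [h2] at hqC
    exact hqC.comp ξ₀ h1.contDiffAt
  have hψ0 : ψ ξ₀ = ζ₀ := by
    have := hql2 (y := ζ₀) (by simpa using hρ)
    simpa [ψ, h0, p] using this
  have hwψ : ∀ᶠ ξ in 𝓝 ξ₀, w ξ = f (ψ ξ) := by
    filter_upwards [h.near hwC.continuous hr ξ₀ ζ₀ h0 ρ hρ] with ξ ⟨ζ, h1, h2⟩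
    have := hql2 (y := ζ) (by rw [Real.dist_eq]; exact h1)
    have h3 : ψ ξ = ζ := by rw [← this]; simp only [ψ, p, h2]
    rw [h3, h2]
  have hψd : ∀ᶠ ξ in 𝓝 ξ₀, DifferentiableAt ℝ ψ ξ := by
    filter_upwards [hψC.eventually (by simp)] with ξ hξ
    exact hξ.differentiableAt (by norm_num)
  have habs : ∀ᶠ ξ in 𝓝 ξ₀, |deriv ψ ξ| = c / cs := by
    filter_upwards [hψd, hwψ.eventually_nhds] with ξ h1 h2
    have h3 : HasDerivAt (fun ξ => f (ψ ξ)) (deriv ψ ξ • deriv f (ψ ξ)) ξ :=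
      (h.hasDeriv (ψ ξ)).scomp ξ h1.hasDerivAt
    have h4 := (hw ξ).unique (h3.congr_of_eventuallyEq h2)
    have h5 := hvc ξ
    rw [h4, norm_smul, hfc, Real.norm_eq_abs] at h5
    rw [eq_div_iff hcs.ne']; exact h5
  have hdc : ContinuousAt (deriv ψ) ξ₀ := by
    have h1 : ContDiffAt ℝ 0 (fderiv ℝ ψ) ξ₀ := hψC.fderiv_right (by norm_num)
    have h2 := h1.continuousAt
    have h3 : deriv ψ = fun x => fderiv ℝ ψ x 1 := by ext x; simp
    rw [h3]
    exact h2.clm_apply continuousAt_const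
  have hpos : 0 < c / cs := by positivity
  refine ⟨deriv ψ ξ₀, habs.self_of_nhds, ?_⟩
  have hdconst : ∀ᶠ ξ in 𝓝 ξ₀, deriv ψ ξ = deriv ψ ξ₀ := by
    filter_upwards [habs, Metric.tendsto_nhds.1 hdc _ hpos] with ξ h1 h2
    rw [Real.dist_eq] at h2
    have h3 := habs.self_of_nhds
    rcases abs_eq_abs.1 (h1.trans h3.symm) with h4 | h4
    · exact h4
    · rw [h4] at h2
      rw [show -deriv ψ ξ₀ - deriv ψ ξ₀ = -(2 * deriv ψ ξ₀) by ring, abs_neg, abs_mul, h3] at h2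
      norm_num at h2
      linarith
  obtain ⟨ε, hε, hball⟩ := Metric.eventually_nhds_iff_ball.1 (hdconst.and hψd)
  filter_upwards [hwψ, Metric.ball_mem_nhds ξ₀ hε] with ξ h1 h2
  rw [h1]
  congr 1
  have := (convex_ball ξ₀ ε).norm_image_sub_le_of_norm_hasDerivWithin_le
    (f := fun x => ψ x - x * deriv ψ ξ₀) (f' := fun _ => 0) (C := 0) (x := ξ₀) (y := ξ)
    (fun x hx => by
      have h5 := ((hball x hx).2.hasDerivAt).sub ((hasDerivAt_id x).mul_const (deriv ψ ξ₀))
      rw [(hball x hx).1] at h5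
      have h6 : deriv ψ ξ₀ - 1 * deriv ψ ξ₀ = 0 := by ring
      rw [h6] at h5
      exact h5.hasDerivWithinAt)
    (fun x _ => by simp) (Metric.mem_ball_self hε) h2
  rw [zero_mul, norm_le_zero_iff, hψ0] at this
  linarith

lemma GC.lift {γ M M' : ℝ} {f : ℝ → R2} (h : GC γ M M' f) {w v : ℝ → R2}
    (hw : ∀ ξ, HasDerivAt w (v ξ) ξ) (hv : Continuous v) {c cs : ℝ} (hc : 0 < c) (hcs : 0 < cs)
    (hvc : ∀ ξ, ‖v ξ‖ = c) (hfc : ∀ ξ, ‖deriv f ξ‖ = cs)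
    (hr : ∀ ξ, ∃ ζ, w ξ = f ζ) :
    ∃ a κ, κ ≠ 0 ∧ ∀ ξ, w ξ = f (a + κ * ξ) := by
  obtain ⟨a, ha⟩ := hr 0
  obtain ⟨κ, hκ, hloc⟩ := h.lift_local hw hv hc hcs hvc hfc hr 0 a ha
  have hder : ∀ κ ζ₁ ξ₁ ξ : ℝ, HasDerivAt (fun x => f (ζ₁ + κ * (x - ξ₁)))
      (κ • deriv f (ζ₁ + κ * (ξ - ξ₁))) ξ := by
    intro κ ζ₁ ξ₁ ξ
    have h1 : HasDerivAt (fun x => ζ₁ + κ * (x - ξ₁)) κ ξ := by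
      simpa using (((hasDerivAt_id ξ).sub_const ξ₁).const_mul κ).const_add ζ₁
    exact (h.hasDeriv (ζ₁ + κ * (ξ - ξ₁))).scomp ξ h1
  refine ⟨a, κ, ?_, ?_⟩
  · rintro rfl
    rw [abs_zero] at hκ
    have : 0 < c / cs := by positivity
    linarith
  have hwc : Continuous w := continuous_iff_continuousAt.2 fun ξ => (hw ξ).continuousAt
  have hfd : Continuous (deriv f) := h.C1.continuous_deriv (by norm_num)
  let S : Set ℝ := {ξ | w ξ = f (a + κ * ξ) ∧ v ξ = κ • deriv f (a + κ * ξ)}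
  have hScl : IsClosed S := by
    apply IsClosed.inter
    · exact isClosed_eq hwc (h.cont.comp (by fun_prop))
    · exact isClosed_eq hv ((hfd.comp (by fun_prop)).const_smul κ)
  have key : ∀ κ' ξ₁, (∀ᶠ ξ in 𝓝 ξ₁, w ξ = f (a + κ * ξ₁ + κ' * (ξ - ξ₁))) →
      v ξ₁ = κ' • deriv f (a + κ * ξ₁) := by
    intro κ' ξ₁ hh
    have h1 := (hw ξ₁).unique ((hder κ' (a + κ * ξ₁) ξ₁ ξ₁).congr_of_eventuallyEq hh)
    simpa using h1
  have h00 : (0 : ℝ) ∈ S := by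
    refine ⟨by simpa using ha, key κ 0 (by simpa using hloc)⟩
  have hSo : IsOpen S := by
    rw [isOpen_iff_mem_nhds]
    rintro ξ₁ ⟨h1, h2⟩
    obtain ⟨κ', hκ', hl⟩ := h.lift_local hw hv hc hcs hvc hfc hr ξ₁ _ h1
    have h3 := key κ' ξ₁ hl
    have h4 : κ' = κ := by
      rw [h2] at h3
      have hne : deriv f (a + κ * ξ₁) ≠ 0 := by
        rw [← norm_pos_iff, hfc]; exact hcs
      exact (smul_left_injective ℝ hne h3).symm
    subst h4
    filter_upwards [hl.eventually_nhds] with ξ hξ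
    have e1 : ∀ x, a + κ' * ξ₁ + κ' * (x - ξ₁) = a + κ' * x := fun x => by ring
    simp only [e1] at hξ
    refine ⟨hξ.self_of_nhds, key κ' ξ ?_⟩
    filter_upwards [hξ] with x hx
    rw [hx]; congr 1; ring
  have : S = univ := IsClopen.eq_univ ⟨hScl, hSo⟩ ⟨0, h00⟩
  intro ξ
  have : ξ ∈ S := by rw [this]; trivial
  exact this.1



lemma perp_zero (v : R2) : perp v 0 = -(v 1) := by simp [perp, mk2]
lemma perp_one (v : R2) : perp v 1 = v 0 := by simp [perp, mk2]

lemma inner2 (v w : R2) : inner ℝ v w = v 0 * w 0 + v 1 * w 1 := by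
  rw [PiLp.inner_apply]; simp [Fin.sum_univ_two]; ring

lemma normsq2 (v : R2) : ‖v‖ ^ 2 = v 0 ^ 2 + v 1 ^ 2 := by
  rw [← real_inner_self_eq_norm_sq, inner2]; ring

lemma perp_cont : Continuous perp := by
  unfold perp mk2
  apply (EuclideanSpace.equiv (Fin 2) ℝ).symm.continuous.comp
  refine continuous_pi fun i => ?_
  fin_cases i
  · simp; fun_prop
  · simp; fun_prop

lemma norm_perp (v : R2) : ‖perp v‖ = ‖v‖ := by
  have : ‖perp v‖ ^ 2 = ‖v‖ ^ 2 := by rw [normsq2, normsq2, perp_zero, perp_one]; ring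
  exact (sq_eq_sq₀ (norm_nonneg _) (norm_nonneg _)).1 this

lemma eq_zero_of_perp {v x : R2} (hv : v ≠ 0) (h1 : inner ℝ v x = 0)
    (h2 : inner ℝ (perp v) x = 0) : x = 0 := by
  rw [inner2] at h1 h2
  rw [perp_zero, perp_one] at h2
  have h3 : 0 < v 0 ^ 2 + v 1 ^ 2 := by
    rw [← normsq2]; have := norm_pos_iff.2 hv; positivity
  have h4 : (v 0 ^ 2 + v 1 ^ 2) * x 0 = 0 := by linear_combination v 0 * h1 - v 1 * h2
  have h5 : (v 0 ^ 2 + v 1 ^ 2) * x 1 = 0 := by linear_combination v 1 * h1 + v 0 * h2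
  have h6 := (mul_eq_zero.1 h4).resolve_left h3.ne'
  have h7 := (mul_eq_zero.1 h5).resolve_left h3.ne'
  ext i; fin_cases i
  · exact h6
  · exact h7

lemma double_cover {f w v : ℝ → R2} (hf : Continuous f) (hw : Continuous w) (hv : Continuous v)
    (hfp : ∀ s, f (s + 2 * π) = f s) (hwp : ∀ s, w (s + 2 * π) = w s)
    (hvp : ∀ s, v (s + 2 * π) = v s) {σ r : ℝ} (hr : 0 < r) (hrσ : 2 * r < σ) (hσ : σ ≤ π)
    (hws : ∀ s, w (s + σ) = w s) (hvs : ∀ s, v (s + σ) = v s)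
    (hmono : ∀ ξ, StrictMonoOn (fun s => inner ℝ (v ξ) (f s)) (Icc (ξ - r) (ξ + r)))
    (hR : ∀ ξ, 0 < inner ℝ (v ξ) (f (ξ + r) - w ξ))
    (hL : ∀ ξ, inner ℝ (v ξ) (f (ξ - r) - w ξ) < 0) :
    ∃ s₁ s₂, f s₁ = f s₂ ∧ 0 < s₂ - s₁ ∧ s₂ - s₁ < 2 * π := by
  let G : ℝ → ℝ → ℝ := fun ξ s => inner ℝ (v ξ) (f s - w ξ)
  have hmono' : ∀ ξ, StrictMonoOn (G ξ) (Icc (ξ - r) (ξ + r)) := by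
    intro ξ a ha b hb hab
    have := hmono ξ ha hb hab
    simp only [G, inner_sub_right]
    simp only at this
    linarith
  have hGc : ∀ ξ, Continuous (G ξ) := by
    intro ξ
    exact continuous_const.inner (hf.sub continuous_const)
  have hGc' : ∀ s, Continuous (fun ξ => G ξ s) := by
    intro s
    exact hv.inner (continuous_const.sub hw)
  have hex : ∀ ξ, ∃ s ∈ Ioo (ξ - r) (ξ + r), G ξ s = 0 := by
    intro ξ
    have := intermediate_value_Ioo (show ξ - r ≤ ξ + r by linarith) (hGc ξ).continuousOn
    obtain ⟨s, hs, h⟩ := this ⟨hL ξ, hR ξ⟩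
    exact ⟨s, hs, h⟩
  choose s hsI hs0 using hex
  have huniq : ∀ ξ t, t ∈ Icc (ξ - r) (ξ + r) → G ξ t = 0 → t = s ξ := by
    intro ξ t ht h
    exact (hmono' ξ).injOn ht (Ioo_subset_Icc_self (hsI ξ)) (h.trans (hs0 ξ).symm)
  have hsc : Continuous s := by
    rw [continuous_iff_continuousAt]
    intro ξ₀
    rw [ContinuousAt, Metric.tendsto_nhds]
    intro ε hε
    have hI := hsI ξ₀
    obtain ⟨a, ha1, ha2⟩ := exists_between (max_lt hI.1 (show s ξ₀ - ε < s ξ₀ by linarith))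
    obtain ⟨b, hb1, hb2⟩ := exists_between (lt_min hI.2 (show s ξ₀ < s ξ₀ + ε by linarith))
    rw [max_lt_iff] at ha1
    rw [lt_min_iff] at hb2
    have hGa : G ξ₀ a < 0 := by
      rw [← hs0 ξ₀]
      exact hmono' ξ₀ ⟨by linarith, by linarith⟩ ⟨by linarith, by linarith⟩ ha2
    have hGb : 0 < G ξ₀ b := by
      rw [← hs0 ξ₀]
      exact hmono' ξ₀ ⟨by linarith, by linarith⟩ ⟨by linarith, by linarith⟩ hb1
    have e1 := (hGc' a).continuousAt.eventually_lt continuousAt_const hGa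
    have e2 := continuousAt_const.eventually_lt (hGc' b).continuousAt hGb
    have e3 : ∀ᶠ ξ in 𝓝 ξ₀, ξ - r < a :=
      (by fun_prop : ContinuousAt (fun ξ => ξ - r) ξ₀).eventually_lt continuousAt_const ha1.1
    have e4 : ∀ᶠ ξ in 𝓝 ξ₀, b < ξ + r :=
      continuousAt_const.eventually_lt (by fun_prop : ContinuousAt (fun ξ => ξ + r) ξ₀) hb2.1
    filter_upwards [e1, e2, e3, e4] with ξ h1 h2 h3 h4
    have k1 : a < s ξ := by
      by_contra hc
      push Not at hc
      have := (hmono' ξ).monotoneOn (Ioo_subset_Icc_self (hsI ξ)) ⟨by linarith, by linarith⟩ hc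
      rw [hs0] at this; linarith
    have k2 : s ξ < b := by
      by_contra hc
      push Not at hc
      have := (hmono' ξ).monotoneOn ⟨by linarith, by linarith⟩ (Ioo_subset_Icc_self (hsI ξ)) hc
      rw [hs0] at this; linarith
    rw [Real.dist_eq, abs_lt]
    constructor <;> linarith
  have hsp : ∀ ξ, s (ξ + 2 * π) = s ξ + 2 * π := by
    intro ξ
    symm
    apply huniq
    · have := hsI ξ; constructor <;> linarith [this.1, this.2]
    · have := hs0 ξ
      simp only [G] at this ⊢
      rw [hvp, hwp, hfp, this]
  let ρ : ℝ → ℝ := fun ξ => inner ℝ (perp (v ξ)) (f (s ξ) - w ξ)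
  have hρc : Continuous ρ := (perp_cont.comp hv).inner ((hf.comp hsc).sub hw)
  have hρp : Function.Periodic ρ (2 * π) := by
    intro ξ
    simp only [ρ]
    rw [hsp, hvp, hwp, hfp]
  have hle : ∃ ξ, ∀ η, ρ η ≤ ρ ξ := by
    obtain ⟨ξ, _, h⟩ := isCompact_Icc.exists_isMaxOn
      (nonempty_Icc.2 (show (0:ℝ) ≤ 0 + 2 * π by positivity)) hρc.continuousOn
    refine ⟨ξ, fun η => ?_⟩
    obtain ⟨y, hy, e⟩ := hρp.exists_mem_Ico (by positivity : (0:ℝ) < 2 * π) η 0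
    rw [e]; exact h (Ico_subset_Icc_self hy)
  have hge : ∃ ξ, ∀ η, ρ ξ ≤ ρ η := by
    obtain ⟨ξ, _, h⟩ := isCompact_Icc.exists_isMinOn
      (nonempty_Icc.2 (show (0:ℝ) ≤ 0 + 2 * π by positivity)) hρc.continuousOn
    refine ⟨ξ, fun η => ?_⟩
    obtain ⟨y, hy, e⟩ := hρp.exists_mem_Ico (by positivity : (0:ℝ) < 2 * π) η 0
    rw [e]; exact h (Ico_subset_Icc_self hy)
  obtain ⟨ξ₁, h1⟩ := hle
  obtain ⟨ξ₂, h2⟩ := hge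
  have hdc : Continuous (fun ξ => ρ (ξ + σ) - ρ ξ) := by fun_prop
  obtain ⟨ξ, hξ⟩ := mem_range_of_exists_le_of_exists_ge hdc
    ⟨ξ₁, sub_nonpos.2 (h1 (ξ₁ + σ))⟩ ⟨ξ₂, sub_nonneg.2 (h2 (ξ₂ + σ))⟩
  have a1 := hs0 ξ
  have a2 := hs0 (ξ + σ)
  simp only [G, ρ] at a1 a2 hξ
  rw [hvs, hws] at a2 hξ
  have hvne : v ξ ≠ 0 := by
    intro h0
    have := hR ξ
    rw [h0] at this; simp at this
  have hz : f (s (ξ + σ)) - f (s ξ) = 0 := by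
    apply eq_zero_of_perp hvne
    · rw [inner_sub_right] at a1 a2 ⊢; linarith
    · simp only [inner_sub_right] at hξ ⊢; linarith
  have i1 := hsI ξ
  have i2 := hsI (ξ + σ)
  refine ⟨s ξ, s (ξ + σ), (sub_eq_zero.1 hz).symm, by linarith [i1.2, i2.1], ?_⟩
  linarith [i1.1, i2.2, Real.pi_pos]



lemma unif_of_equi {ι : Type*} {l : Filter ι} {G : ι → ℝ → R2} {g : ℝ → R2}
    (hG : ∀ ε > 0, ∃ ρ > 0, ∀ᶠ i in l, ∀ ξ η : ℝ, |ξ - η| < ρ → ‖G i ξ - G i η‖ < ε)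
    (hg : ∀ ε > 0, ∃ ρ > 0, ∀ ξ η : ℝ, |ξ - η| < ρ → ‖g ξ - g η‖ < ε)
    (hGp : ∀ᶠ i in l, Function.Periodic (G i) (2 * π)) (hgp : Function.Periodic g (2 * π))
    (hpt : ∀ ξ, Tendsto (fun i => G i ξ) l (𝓝 (g ξ))) :
    ∀ ε > 0, ∀ᶠ i in l, ∀ ξ, ‖G i ξ - g ξ‖ < ε := by
  intro ε hε
  obtain ⟨ρ1, hρ1, h1⟩ := hG (ε / 3) (by positivity)
  obtain ⟨ρ2, hρ2, h2⟩ := hg (ε / 3) (by positivity)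
  obtain ⟨t, ht, hcov⟩ := Metric.totallyBounded_iff.1
    (isCompact_Icc (a := (0 : ℝ)) (b := 0 + 2 * π)).totallyBounded (min ρ1 ρ2) (lt_min hρ1 hρ2)
  have h3 : ∀ᶠ i in l, ∀ y ∈ t, ‖G i y - g y‖ < ε / 3 := by
    rw [eventually_all_finite ht]
    intro y _
    have := Metric.tendsto_nhds.1 (hpt y) (ε / 3) (by positivity)
    simpa [dist_eq_norm] using this
  filter_upwards [h1, h3, hGp] with i a1 a3 ap ξ
  have hsum : Function.Periodic (fun ξ => G i ξ - g ξ) (2 * π) := fun x => by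
    simp only [ap x, hgp x]
  obtain ⟨x, hx, e⟩ := hsum.exists_mem_Ico (by positivity : (0:ℝ) < 2 * π) ξ 0
  rw [show ‖G i ξ - g ξ‖ = ‖G i x - g x‖ from congrArg norm e]
  obtain ⟨y, hy, hxy⟩ := mem_iUnion₂.1 (hcov (Ico_subset_Icc_self hx))
  rw [Metric.mem_ball, Real.dist_eq, lt_min_iff] at hxy
  have b1 := a1 x y hxy.1
  have b2 := h2 x y hxy.2
  have b3 := a3 y hy
  have e2 : G i x - g x = (G i x - G i y) + (G i y - g y) - (g x - g y) := by abel
  rw [e2]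
  calc _ ≤ ‖(G i x - G i y) + (G i y - g y)‖ + ‖g x - g y‖ := norm_sub_le _ _
    _ ≤ ‖G i x - G i y‖ + ‖G i y - g y‖ + ‖g x - g y‖ := by gcongr; exact norm_add_le _ _
    _ < ε := by linarith

lemma inner_pos_of_near {v x : R2} {c t : ℝ} (hc : 0 < c) (ht : 0 < t) (hv : ‖v‖ = c)
    (h : ‖x - t • v‖ ≤ 3 / 4 * t * c) : 0 < inner ℝ v x := by
  have h1 : inner ℝ v x = t * c ^ 2 + inner ℝ v (x - t • v) := by
    rw [inner_sub_right, inner_smul_right, real_inner_self_eq_norm_sq, hv]; ring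
  have h2 := abs_real_inner_le_norm v (x - t • v)
  rw [hv] at h2
  have h3 := (abs_le.1 h2).1
  have h4 : c * ‖x - t • v‖ ≤ c * (3 / 4 * t * c) := by gcongr
  have h5 : 0 < t * c ^ 2 := by positivity
  nlinarith

lemma exists_small_rpow {γ : ℝ} (hγ : 0 < γ) (M ε r₀ : ℝ) (hM : 0 < M) (hε : 0 < ε) (hr₀ : 0 < r₀) :
    ∃ r, 0 < r ∧ r ≤ r₀ ∧ M * r ^ γ ≤ ε := by
  refine ⟨min r₀ ((ε / M) ^ (1 / γ)), lt_min hr₀ (by positivity), min_le_left _ _, ?_⟩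
  have : (min r₀ ((ε / M) ^ (1 / γ))) ^ γ ≤ ((ε / M) ^ (1 / γ)) ^ γ := by
    gcongr
    exact min_le_right _ _
  rw [← rpow_mul (by positivity), one_div_mul_cancel hγ.ne', rpow_one] at this
  calc _ ≤ M * (ε / M) := by gcongr
    _ = ε := by field_simp

lemma GC.ultralimit {ι : Type*} (U : Ultrafilter ι) (F : ι → ℝ → R2) {γ M M' : ℝ} (hγ : 0 < γ)
    (hM' : 0 < M') (hM : 0 < M) (hF : ∀ᶠ i in (U : Filter ι), GC γ M M' (F i)) {f : ℝ → R2}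
    (h : GC γ M M' f)
    (hH : ∀ ε > 0, ∀ᶠ i in (U : Filter ι), ∀ ξ, ∃ ζ, ‖F i ξ - f ζ‖ < ε) :
    ∃ a κ, (κ = 1 ∨ κ = -1) ∧ ∀ ξ, Tendsto (fun i => F i ξ) U (𝓝 (f (a + κ * ξ))) := by
  have exlim : ∀ G : ι → R2, (∀ᶠ i in (U : Filter ι), ‖G i‖ ≤ M) →
      ∃ x, Tendsto G U (𝓝 x) := by
    intro G hG
    obtain ⟨x, _, hx⟩ := (isCompact_closedBall (0 : R2) M).ultrafilter_le_nhds (U.map G) (by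
      rw [le_principal_iff]
      change G ⁻¹' (Metric.closedBall 0 M) ∈ (U : Filter ι)
      filter_upwards [hG] with i hi
      simpa using hi)
    exact ⟨x, hx⟩
  choose w hw using fun ξ => exlim (fun i => F i ξ) (hF.mono fun i hi => hi.bd ξ)
  choose v hv using fun ξ => exlim (fun i => deriv (F i) ξ) (hF.mono fun i hi => hi.dbd ξ)
  have hT : ∀ ξ η, ‖w η - w ξ - (η - ξ) • v ξ‖ ≤ M * |η - ξ| ^ γ * |η - ξ| := by
    intro ξ η
    refine le_of_tendsto ((((hw η).sub (hw ξ)).sub ((hv ξ).const_smul (η - ξ))).norm) ?_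
    exact hF.mono fun i hi => hi.taylor' hγ.le hM.le ξ η
  have hvH : ∀ ξ η, ‖v ξ - v η‖ ≤ M * |ξ - η| ^ γ := fun ξ η =>
    le_of_tendsto (((hv ξ).sub (hv η)).norm) (hF.mono fun i hi => hi.hol ξ η)
  have hwL : ∀ ξ η, ‖w ξ - w η‖ ≤ M * |ξ - η| := fun ξ η =>
    le_of_tendsto (((hw ξ).sub (hw η)).norm) (hF.mono fun i hi => hi.lip ξ η)
  have hwp : Function.Periodic w (2 * π) := fun ξ =>
    tendsto_nhds_unique (hw (ξ + 2 * π)) ((hw ξ).congr' (hF.mono fun i hi => (hi.per ξ).symm))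
  have hvc : ∀ ξ, ‖v ξ‖ = ‖v 0‖ := fun ξ => by
    refine tendsto_nhds_unique (hv ξ).norm ((hv 0).norm.congr' (hF.mono fun i hi => ?_))
    obtain ⟨c, _, hc⟩ := hi.speed
    simp only [hc]
  have hc : 0 < ‖v 0‖ :=
    hM'.trans_le (ge_of_tendsto (hv 0).norm (hF.mono fun i hi => hi.low 0))
  have hwd : ∀ ξ, HasDerivAt w (v ξ) ξ := by
    intro ξ
    rw [hasDerivAt_iff_isLittleO, Asymptotics.isLittleO_iff]
    intro ε hε
    obtain ⟨r, hr, _, hrε⟩ := exists_small_rpow hγ M ε 1 hM hε one_pos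
    filter_upwards [Metric.ball_mem_nhds ξ hr] with η hη
    rw [Metric.mem_ball, Real.dist_eq] at hη
    refine (hT ξ η).trans ?_
    rw [Real.norm_eq_abs]
    gcongr
    refine le_trans ?_ hrε
    gcongr
  have hwcont : Continuous w := continuous_iff_continuousAt.2 fun ξ => (hwd ξ).continuousAt
  have hveq : ∀ (ε : ℝ), ε > 0 → ∃ ρ > 0, ∀ ξ η : ℝ, |ξ - η| < ρ → M * |ξ - η| ^ γ < ε := by
    intro ε hε
    obtain ⟨r, hr, _, hrε⟩ := exists_small_rpow hγ M (ε / 2) 1 hM (by positivity) one_pos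
    refine ⟨r, hr, fun ξ η hξ => ?_⟩
    have : M * |ξ - η| ^ γ ≤ M * r ^ γ := by gcongr
    linarith
  have hweq : ∀ (ε : ℝ), ε > 0 → ∃ ρ > 0, ∀ ξ η : ℝ, |ξ - η| < ρ → M * |ξ - η| < ε := by
    intro ε hε
    refine ⟨ε / M, by positivity, fun ξ η hξ => ?_⟩
    rw [lt_div_iff₀ hM] at hξ; linarith
  have hvcont : Continuous v := by
    rw [Metric.continuous_iff]
    intro ξ ε hε
    obtain ⟨ρ, hρ, h1⟩ := hveq ε hε
    refine ⟨ρ, hρ, fun η hη => ?_⟩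
    rw [dist_eq_norm]
    exact (hvH _ _).trans_lt (h1 _ _ (by rwa [Real.dist_eq] at hη))
  have hper_of : ∀ σ, (∀ s, w (s + σ) = w s) → ∀ s, v (s + σ) = v s := by
    intro σ hσ s
    have h1 : HasDerivAt (fun x => w (x + σ)) (v (s + σ)) s := (hwd (s + σ)).comp_add_const s σ
    have h2 : (fun x => w (x + σ)) = w := funext hσ
    rw [h2] at h1
    exact h1.unique (hwd s)
  have hvp := hper_of _ hwp
  have hrange : ∀ ξ, ∃ ζ, w ξ = f ζ := by
    have hcl : IsClosed (range f) := by
      have hfp : Function.Periodic f (2 * π) := h.per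
      rw [← hfp.image_Icc (by positivity : (0:ℝ) < 2 * π) 0]
      exact (isCompact_Icc.image h.cont).isClosed
    intro ξ
    have : w ξ ∈ closure (range f) := by
      rw [Metric.mem_closure_iff]
      intro ε hε
      have h1 := hH (ε / 2) (by positivity)
      have h2 := Metric.tendsto_nhds.1 (hw ξ) (ε / 2) (by positivity)
      obtain ⟨i, a1, a2⟩ := (h1.and h2).exists
      obtain ⟨ζ, hζ⟩ := a1 ξ
      refine ⟨f ζ, ⟨ζ, rfl⟩, ?_⟩
      rw [← dist_eq_norm] at hζ
      have := dist_triangle_left (w ξ) (f ζ) (F i ξ)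
      linarith
    rw [hcl.closure_eq] at this
    obtain ⟨ζ, hζ⟩ := this
    exact ⟨ζ, hζ.symm⟩
  obtain ⟨cs, hcs, hfc⟩ := h.speed
  obtain ⟨a, κ, hκ, hwf⟩ := h.lift hwd hvcont hc hcs hvc hfc hrange
  refine ⟨a, κ, ?_, fun ξ => by rw [← hwf]; exact hw ξ⟩
  obtain ⟨k, hk⟩ : ∃ k : ℤ, κ = k := by
    have h1 := hwp 0
    rw [hwf, hwf] at h1
    obtain ⟨k, hk⟩ := h.injz h1
    refine ⟨k, ?_⟩
    have : (2 * π) * (κ - k) = 0 := by linarith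
    have h3 := (mul_eq_zero.1 this).resolve_left (by positivity)
    linarith
  by_contra hcon
  have hk2 : 2 ≤ |k| := by
    have h0 : k ≠ 0 := by rintro rfl; simp [hk] at hκ
    have h1 : k ≠ 1 := by rintro rfl; simp [hk] at hcon
    have h2 : k ≠ -1 := by rintro rfl; simp [hk] at hcon
    rcases abs_cases k with ⟨e, _⟩ | ⟨e, _⟩ <;> omega
  have hk2' : (2 : ℝ) ≤ |κ| := by rw [hk]; exact_mod_cast hk2
  have hκp : 0 < |κ| := by linarith
  set σ := 2 * π / |κ| with hσ
  have hσ0 : 0 < σ := by positivity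
  have hσπ : σ ≤ π := by
    rw [hσ, div_le_iff₀ hκp]; nlinarith [Real.pi_pos]
  have hws : ∀ s, w (s + σ) = w s := by
    intro s
    rw [hwf, hwf]
    have hκσ : κ * σ = 2 * π ∨ κ * σ = -(2 * π) := by
      rw [hσ]
      rcases abs_cases κ with ⟨e, _⟩ | ⟨e, _⟩
      · left; rw [e]; field_simp
      · right; rw [e]; field_simp
    rcases hκσ with e | e
    · have := h.perz (a + κ * s) 1
      rw [← this]; congr 1; push_cast; linarith
    · have := h.perz (a + κ * s) (-1)
      rw [← this]; congr 1; push_cast; linarith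
  have hvs := hper_of _ hws
  obtain ⟨r, hr, hr1, hr2⟩ := exists_small_rpow hγ M (‖v 0‖ / 4) (σ / 4) hM (by positivity)
    (by positivity)
  have u1 := unif_of_equi (l := (U : Filter ι)) (G := F) (g := w)
    (fun ε hε => by
      obtain ⟨ρ, hρ, h1⟩ := hweq ε hε
      exact ⟨ρ, hρ, hF.mono fun i hi ξ η hξ => (hi.lip ξ η).trans_lt (h1 ξ η hξ)⟩)
    (fun ε hε => by
      obtain ⟨ρ, hρ, h1⟩ := hweq ε hε
      exact ⟨ρ, hρ, fun ξ η hξ => (hwL ξ η).trans_lt (h1 ξ η hξ)⟩)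
    (hF.mono fun i hi => hi.per) hwp hw (r * ‖v 0‖ / 4) (by positivity)
  have u2 := unif_of_equi (l := (U : Filter ι)) (G := fun i => deriv (F i)) (g := v)
    (fun ε hε => by
      obtain ⟨ρ, hρ, h1⟩ := hveq ε hε
      exact ⟨ρ, hρ, hF.mono fun i hi ξ η hξ => (hi.hol ξ η).trans_lt (h1 ξ η hξ)⟩)
    (fun ε hε => by
      obtain ⟨ρ, hρ, h1⟩ := hveq ε hε
      exact ⟨ρ, hρ, fun ξ η hξ => (hvH ξ η).trans_lt (h1 ξ η hξ)⟩)
    (hF.mono fun i hi ξ => by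
      have h1 : HasDerivAt (fun x => F i (x + 2 * π)) (deriv (F i) (ξ + 2 * π)) ξ :=
        (hi.hasDeriv (ξ + 2 * π)).comp_add_const ξ (2 * π)
      have h2 : (fun x => F i (x + 2 * π)) = F i := funext hi.per
      rw [h2] at h1
      exact h1.unique (hi.hasDeriv ξ)) hvp hv (‖v 0‖ / 4) (by positivity)
  obtain ⟨i, hi, b1, b2⟩ := (hF.and (u1.and u2)).exists
  have e4 : ∀ ξ t : ℝ, |t| = r → ‖F i (ξ + t) - w ξ - t • v ξ‖ ≤ 3 / 4 * r * ‖v 0‖ := by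
    intro ξ t ht
    have e1 : F i (ξ + t) - w ξ - t • v ξ = (F i (ξ + t) - F i ξ - (ξ + t - ξ) • deriv (F i) ξ)
        + t • (deriv (F i) ξ - v ξ) + (F i ξ - w ξ) := by
      rw [smul_sub, add_sub_cancel_left]; abel
    have c1 := hi.taylor' hγ.le hM.le ξ (ξ + t)
    have c2 := b2 ξ
    have c3 := b1 ξ
    rw [e1]
    rw [add_sub_cancel_left] at c1 ⊢
    rw [ht] at c1
    calc _ ≤ ‖F i (ξ + t) - F i ξ - t • deriv (F i) ξ‖
          + ‖t • (deriv (F i) ξ - v ξ)‖ + ‖F i ξ - w ξ‖ := norm_add₃_le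
      _ ≤ M * r ^ γ * r + r * (‖v 0‖ / 4) + r * ‖v 0‖ / 4 := by
          rw [norm_smul, Real.norm_eq_abs, ht]
          gcongr
      _ ≤ ‖v 0‖ / 4 * r + r * (‖v 0‖ / 4) + r * ‖v 0‖ / 4 := by gcongr
      _ = _ := by ring
  obtain ⟨s₁, s₂, e, p1, p2⟩ := double_cover hi.cont hwcont hvcont hi.per hwp hvp hr
    (show 2 * r < σ by linarith) hσπ hws hvs
    (by
      intro ξ
      apply strictMonoOn_of_deriv_pos (convex_Icc _ _)
      · exact (continuous_const.inner hi.cont).continuousOn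
      · intro s hs
        rw [interior_Icc] at hs
        have hd : HasDerivAt (fun s => inner ℝ (v ξ) (F i s)) (inner ℝ (v ξ) (deriv (F i) s)) s := by
          have := (hasDerivAt_const s (v ξ)).inner ℝ (hi.hasDeriv s)
          rw [inner_zero_left, add_zero] at this
          exact this
        rw [hd.deriv]
        apply inner_pos_of_near hc one_pos (hvc ξ)
        rw [one_smul]
        have d1 := hi.hol s ξ
        have d2 := b2 ξ
        have d3 : |s - ξ| ≤ r := by rw [abs_le]; constructor <;> linarith [hs.1, hs.2]
        have d4 : M * |s - ξ| ^ γ ≤ M * r ^ γ := by gcongr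
        have d5 := norm_add_le (deriv (F i) s - deriv (F i) ξ) (deriv (F i) ξ - v ξ)
        rw [sub_add_sub_cancel] at d5
        linarith)
    (by
      intro ξ
      exact inner_pos_of_near hc hr (hvc ξ) (e4 ξ r (abs_of_pos hr)))
    (by
      intro ξ
      have := e4 ξ (-r) (by rw [abs_neg, abs_of_pos hr])
      have h2 := inner_pos_of_near (x := -(F i (ξ - r) - w ξ)) hc hr (hvc ξ) (by
        rw [← norm_neg] at this
        have e5 : -(F i (ξ - r) - w ξ) - r • v ξ = -(F i (ξ + -r) - w ξ - -r • v ξ) := by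
          rw [neg_smul, ← sub_eq_add_neg]; abel
        rw [e5]; exact this)
      rw [inner_neg_right] at h2
      linarith)
  obtain ⟨j, hj⟩ := hi.injz e.symm
  have hj1 : (0:ℝ) < 2 * π * j := by linarith
  have hj2 : 2 * π * (j : ℝ) < 2 * π * 1 := by linarith
  have hp2 : (0 : ℝ) < 2 * π := by positivity
  have hj3 : (0 : ℝ) < j := by
    by_contra hc'
    push Not at hc'
    nlinarith
  have hj4 : (j : ℝ) < 1 := lt_of_mul_lt_mul_left hj2 hp2.le
  have : (0 : ℤ) < j := by exact_mod_cast hj3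
  have : j < (1 : ℤ) := by exact_mod_cast hj4
  omega



/-- The odd kernel difference in adapted coordinates. -/
def KF (α m : ℝ) (q : ℝ × ℝ) : ℝ :=
  q.1 * ((q.1 ^ 2 + (q.2 - m) ^ 2) ^ (-(1 + α)) - (q.1 ^ 2 + q.2 ^ 2) ^ (-(1 + α)))

lemma rpow_mvt {α L t T : ℝ} (hα : 0 < α) (hL : 0 < L) (ht : L ≤ t) (hT : L ≤ T) :
    |T ^ (-(1 + α)) - t ^ (-(1 + α))| ≤ (1 + α) * L ^ (-(2 + α)) * |T - t| := by
  have := (convex_Ici L).norm_image_sub_le_of_norm_hasDerivWithin_le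
    (f := fun x : ℝ => x ^ (-(1 + α))) (f' := fun x => (-(1 + α)) * x ^ (-(1 + α) - 1))
    (C := (1 + α) * L ^ (-(2 + α))) (x := t) (y := T)
    (fun x hx => (Real.hasDerivAt_rpow_const (Or.inl (hL.trans_le hx).ne')).hasDerivWithinAt)
    (fun x hx => by
      have hx' : L ≤ x := hx
      rw [norm_mul, Real.norm_eq_abs, abs_neg, abs_of_pos (by positivity : 0 < 1 + α),
        Real.norm_eq_abs, abs_of_pos (by have := hL.trans_le hx'; positivity)]
      rw [show -(1 + α) - 1 = -(2 + α) by ring]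
      gcongr ?_ * ?_
      exact Real.rpow_le_rpow_of_nonpos hL hx' (by linarith)) ht hT
  exact this

/-- bound on the part of the kernel near the two curves -/
lemma KF_near {α C m s p : ℝ} (hα : 0 < α) (hα2 : α < 1 / 2) (hC : 0 < C) (hm : 0 < m)
    (hs : s ≠ 0) (hN : |p| ≤ C * |s| ^ (1 + 2 * α) ∨ |p - m| ≤ C * |s| ^ (1 + 2 * α)) :
    |KF α m (s, p)| ≤ (36 * C + 12 * C ^ 2) * (m ^ 2 / (m ^ 2 + s ^ 2) + m * |s| ^ (2 * α - 1))
      / (4 * C * |s| ^ (1 + 2 * α)) := by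
  have hs0 : 0 < |s| := abs_pos.2 hs
  have hs2 : s ^ 2 = |s| ^ 2 := (sq_abs s).symm
  have hp2 : ∀ x : ℝ, (s ^ 2) ^ x = |s| ^ (2 * x) := by
    intro x
    rw [hs2, ← Real.rpow_natCast, ← Real.rpow_mul hs0.le]; norm_num
  have hss : 0 < s ^ 2 := by positivity
  have hm2 : 0 < m ^ 2 := by positivity
  set A := |s| ^ (1 + 2 * α) with hA
  have hA0 : 0 < A := by positivity
  rw [le_div_iff₀ (by positivity)]
  unfold KF
  simp only
  rw [abs_mul]
  set D := (s ^ 2 + (p - m) ^ 2) ^ (-(1 + α)) - (s ^ 2 + p ^ 2) ^ (-(1 + α)) with hD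
  have hX : 0 < m * |s| ^ (2 * α - 1) := by positivity
  by_cases hsm : |s| ≤ m
  · have b1 : (s ^ 2 + (p - m) ^ 2) ^ (-(1 + α)) ≤ (s ^ 2) ^ (-(1 + α)) :=
      Real.rpow_le_rpow_of_nonpos hss (by nlinarith [sq_nonneg (p - m)]) (by linarith)
    have b2 : (s ^ 2 + p ^ 2) ^ (-(1 + α)) ≤ (s ^ 2) ^ (-(1 + α)) :=
      Real.rpow_le_rpow_of_nonpos hss (by nlinarith [sq_nonneg p]) (by linarith)
    have b3 : 0 ≤ (s ^ 2 + (p - m) ^ 2) ^ (-(1 + α)) := by positivity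
    have b4 : 0 ≤ (s ^ 2 + p ^ 2) ^ (-(1 + α)) := by positivity
    have b5 : |D| ≤ (s ^ 2) ^ (-(1 + α)) := by rw [abs_le]; constructor <;> linarith
    rw [hp2] at b5
    have b6 : |s| * |s| ^ (2 * -(1 + α)) * A = 1 := by
      rw [hA, ← Real.rpow_one_add' hs0.le (by linarith), ← Real.rpow_add hs0]
      rw [show 1 + 2 * -(1 + α) + (1 + 2 * α) = 0 by ring, Real.rpow_zero]
    have b7 : 1 / 2 ≤ m ^ 2 / (m ^ 2 + s ^ 2) := by
      rw [div_le_div_iff₀ (by norm_num) (by positivity), hs2]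
      have : |s| ^ 2 ≤ m ^ 2 := by gcongr
      linarith
    calc |s| * |D| * (4 * C * A) ≤ |s| * |s| ^ (2 * -(1 + α)) * (4 * C * A) := by gcongr
      _ = 4 * C * (|s| * |s| ^ (2 * -(1 + α)) * A) := by ring
      _ = 4 * C := by rw [b6, mul_one]
      _ ≤ (36 * C + 12 * C ^ 2) * (1 / 2 + 0) := by nlinarith [sq_nonneg C]
      _ ≤ _ := by gcongr
  · push Not at hsm
    have c1 := rpow_mvt (α := α) (t := s ^ 2 + p ^ 2) (T := s ^ 2 + (p - m) ^ 2) hα hss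
      (by nlinarith [sq_nonneg p]) (by nlinarith [sq_nonneg (p - m)])
    rw [← hD, hp2, show s ^ 2 + (p - m) ^ 2 - (s ^ 2 + p ^ 2) = m * (m - 2 * p) by ring, abs_mul,
      abs_of_pos hm] at c1
    have c2 : |m - 2 * p| ≤ 3 * m + 2 * C * A := by
      rcases hN with h | h
      · rw [abs_le] at h ⊢; constructor <;> nlinarith [h.1, h.2]
      · rw [abs_le] at h ⊢; constructor <;> nlinarith [h.1, h.2]
    have c3 : |s| * |s| ^ (2 * -(2 + α)) * A = (|s| ^ 2)⁻¹ := by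
      rw [hA, ← Real.rpow_one_add' hs0.le (by linarith), ← Real.rpow_add hs0]
      rw [show 1 + 2 * -(2 + α) + (1 + 2 * α) = -((2 : ℕ) : ℝ) by push_cast; ring, Real.rpow_neg hs0.le,
        Real.rpow_natCast]
    have c4 : (|s| ^ 2)⁻¹ * A = |s| ^ (2 * α - 1) := by
      rw [hA, ← Real.rpow_natCast, ← Real.rpow_neg hs0.le, ← Real.rpow_add hs0]
      congr 1; push_cast; ring
    have c5 : m ^ 2 * (|s| ^ 2)⁻¹ ≤ 2 * (m ^ 2 / (m ^ 2 + s ^ 2)) := by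
      rw [← div_eq_mul_inv, ← mul_div_assoc, div_le_div_iff₀ (by positivity) (by positivity), hs2]
      have : m ^ 2 ≤ |s| ^ 2 := by gcongr
      nlinarith
    calc |s| * |D| * (4 * C * A)
        ≤ |s| * ((1 + α) * |s| ^ (2 * -(2 + α)) * (m * (3 * m + 2 * C * A))) * (4 * C * A) := by
          gcongr
          refine c1.trans ?_
          gcongr
      _ = (1 + α) * 4 * C * m * (3 * m + 2 * C * A) * (|s| * |s| ^ (2 * -(2 + α)) * A) := by ring
      _ = (1 + α) * (12 * C * (m ^ 2 * (|s| ^ 2)⁻¹) + 8 * C ^ 2 * (m * ((|s| ^ 2)⁻¹ * A))) := by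
          rw [c3]; ring
      _ ≤ (3 / 2) * (12 * C * (2 * (m ^ 2 / (m ^ 2 + s ^ 2))) + 8 * C ^ 2 * (m * |s| ^ (2 * α - 1))) := by
          rw [c4]; gcongr; linarith
      _ ≤ _ := by
          have hY : 0 < m ^ 2 / (m ^ 2 + s ^ 2) := by positivity
          set Y := m ^ 2 / (m ^ 2 + s ^ 2)
          set X := m * |s| ^ (2 * α - 1)
          have : 0 ≤ 12 * C ^ 2 * Y := by positivity
          have : 0 ≤ 36 * C * X := by positivity
          nlinarith

lemma KF_far {α R m s p : ℝ} (hα : 0 < α) (hα2 : α < 1 / 2) (hR : 0 < R) (hm : 0 < m)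
    (hmR : m ≤ R / 2) (hfar : R ^ 2 ≤ s ^ 2 + p ^ 2) :
    |KF α m (s, p)| ≤ 384 * (1 + 1 / R) ^ (2 + 2 * α) * m *
      (1 + ‖((s, p) : ℝ × ℝ)‖) ^ (-(2 + 2 * α)) := by
  set a := √(s ^ 2 + p ^ 2) with ha
  have haR : R ≤ a := Real.le_sqrt_of_sq_le hfar
  have ha0 : 0 < a := hR.trans_le haR
  have haa : a ^ 2 = s ^ 2 + p ^ 2 := Real.sq_sqrt (by positivity)
  have hsa : |s| ≤ a := Real.abs_le_sqrt (by nlinarith [sq_nonneg p])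
  have hpa : |p| ≤ a := Real.abs_le_sqrt (by nlinarith [sq_nonneg s])
  have hL : 0 < a ^ 2 / 4 := by positivity
  have hpa' := abs_le.1 hpa
  have c1 := rpow_mvt (α := α) (t := s ^ 2 + p ^ 2) (T := s ^ 2 + (p - m) ^ 2) hα hL
      (by linarith) (by nlinarith [mul_nonneg hm.le (sub_nonneg.2 hpa'.2)])
  rw [show s ^ 2 + (p - m) ^ 2 - (s ^ 2 + p ^ 2) = m * (m - 2 * p) by ring, abs_mul,
      abs_of_pos hm] at c1
  have c2 : |m - 2 * p| ≤ 3 * a := by rw [abs_le]; constructor <;> linarith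
  have c3 : (a ^ 2 / 4) ^ (-(2 + α)) ≤ 64 * a ^ (-(4 + 2 * α)) := by
    rw [Real.div_rpow (by positivity) (by norm_num), ← Real.rpow_natCast, ← Real.rpow_mul ha0.le,
      Real.rpow_neg (by norm_num : (0:ℝ) ≤ 4), div_inv_eq_mul, mul_comm]
    rw [show ((2 : ℕ) : ℝ) * -(2 + α) = -(4 + 2 * α) by push_cast; ring]
    gcongr
    calc (4 : ℝ) ^ (2 + α) ≤ 4 ^ ((3 : ℕ) : ℝ) :=
          Real.rpow_le_rpow_of_exponent_le (by norm_num) (by push_cast; linarith)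
      _ = 64 := by rw [Real.rpow_natCast]; norm_num
  have c4 : a * a * a ^ (-(4 + 2 * α)) = a ^ (-(2 + 2 * α)) := by
    rw [mul_assoc, ← Real.rpow_one_add' ha0.le (by linarith), ← Real.rpow_one_add' ha0.le (by linarith)]
    congr 1; ring
  have c5 : 1 + ‖((s, p) : ℝ × ℝ)‖ ≤ (1 + 1 / R) * a := by
    have h1 : ‖((s, p) : ℝ × ℝ)‖ ≤ a := by
      rw [Prod.norm_def]; exact max_le hsa hpa
    have h2 : 1 ≤ 1 / R * a := by rw [one_div, ← div_eq_inv_mul, le_div_iff₀ hR]; linarith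
    linarith
  have c6 : a ^ (-(2 + 2 * α)) ≤ (1 + 1 / R) ^ (2 + 2 * α) * (1 + ‖((s, p) : ℝ × ℝ)‖) ^ (-(2 + 2 * α)) := by
    have h1 : ((1 + 1 / R) * a) ^ (-(2 + 2 * α)) ≤ (1 + ‖((s, p) : ℝ × ℝ)‖) ^ (-(2 + 2 * α)) :=
      Real.rpow_le_rpow_of_nonpos (by positivity) c5 (by linarith)
    rw [Real.mul_rpow (by positivity) ha0.le] at h1
    calc a ^ (-(2 + 2 * α)) = (1 + 1 / R) ^ (2 + 2 * α) * ((1 + 1 / R) ^ (-(2 + 2 * α)) * a ^ (-(2 + 2 * α))) := by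
          rw [← mul_assoc, ← Real.rpow_add (by positivity), add_neg_cancel, Real.rpow_zero, one_mul]
      _ ≤ _ := by gcongr
  unfold KF
  simp only
  rw [abs_mul]
  calc _ ≤ a * (2 * (64 * a ^ (-(4 + 2 * α))) * (m * (3 * a))) := by
        gcongr
        refine c1.trans ?_
        gcongr
        linarith
    _ = 384 * m * (a * a * a ^ (-(4 + 2 * α))) := by ring
    _ ≤ 384 * m * ((1 + 1 / R) ^ (2 + 2 * α) * (1 + ‖((s, p) : ℝ × ℝ)‖) ^ (-(2 + 2 * α))) := by
        rw [c4]; gcongr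
    _ = _ := by ring



lemma KF_meas (α m : ℝ) : Measurable (KF α m) := by
  unfold KF
  fun_prop

lemma near_one_dim {α : ℝ} (hα : 0 < α) :
    ∃ J : ℝ, 0 ≤ J ∧ ∀ K m : ℝ, 0 < K → 0 < m →
      ∫⁻ s in Ioo (-1 : ℝ) 1, ENNReal.ofReal (K * (m ^ 2 / (m ^ 2 + s ^ 2) + m * |s| ^ (2 * α - 1)))
        ≤ ENNReal.ofReal (K * (π + J) * m) := by
  have hI : IntegrableOn (fun s : ℝ => |s| ^ (2 * α - 1)) (Ioo (-1 : ℝ) 1) := by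
    have := integrableOn_ball_of_norm_le_rpow (E := ℝ) (F := ℝ) (μ := volume)
      (f := fun s : ℝ => |s| ^ (2 * α - 1)) (C := 1) (α := 1 - 2 * α) (r := 1) (by simp)
      (by simp; linarith) (Eventually.of_forall fun x => by
        rw [Real.norm_eq_abs, Real.norm_eq_abs, abs_of_nonneg (by positivity)]
        rw [one_mul, neg_sub])
      (Measurable.aestronglyMeasurable (by fun_prop))
    rw [Real.ball_eq_Ioo] at this
    simpa using this
  refine ⟨∫ s in Ioo (-1 : ℝ) 1, |s| ^ (2 * α - 1), integral_nonneg fun s => by positivity, ?_⟩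
  intro K m hK hm
  have e1 : ∀ s : ℝ, m ^ 2 / (m ^ 2 + s ^ 2) = (1 + (s / m) ^ 2)⁻¹ := by
    intro s
    have : 0 < m ^ 2 + s ^ 2 := by positivity
    field_simp
  have h1 : Integrable (fun s : ℝ => m ^ 2 / (m ^ 2 + s ^ 2)) := by
    simp_rw [e1]
    exact integrable_inv_one_add_sq.comp_div hm.ne'
  have h2 : ∫ s : ℝ, m ^ 2 / (m ^ 2 + s ^ 2) = π * m := by
    simp_rw [e1]
    rw [Measure.integral_comp_div (fun x : ℝ => (1 + x ^ 2)⁻¹), integral_univ_inv_one_add_sq, abs_of_pos hm]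
    simp [mul_comm]
  rw [← ofReal_integral_eq_lintegral_ofReal]
  · apply ENNReal.ofReal_le_ofReal
    rw [integral_const_mul, integral_add h1.integrableOn (hI.const_mul m), integral_const_mul]
    have h3 : ∫ s in Ioo (-1 : ℝ) 1, m ^ 2 / (m ^ 2 + s ^ 2) ≤ π * m := by
      rw [← h2]
      exact setIntegral_le_integral h1 (Eventually.of_forall fun s => by positivity)
    calc _ ≤ K * (π * m + m * ∫ s in Ioo (-1 : ℝ) 1, |s| ^ (2 * α - 1)) := by gcongr
      _ = _ := by ring
  · exact (h1.integrableOn.add (hI.const_mul m)).const_mul K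
  · exact Eventually.of_forall fun s => by positivity

def Nset (α C m : ℝ) : Set (ℝ × ℝ) := {q | |q.1| < 1 ∧
  (|q.2| ≤ C * |q.1| ^ (1 + 2 * α) ∨ |q.2 - m| ≤ C * |q.1| ^ (1 + 2 * α))}

lemma Nset_meas (α C m : ℝ) : MeasurableSet (Nset α C m) := by
  unfold Nset
  have a1 : Measurable (fun q : ℝ × ℝ => |q.1|) := by fun_prop
  have a2 : Measurable (fun q : ℝ × ℝ => |q.2|) := by fun_prop
  have a4 : Measurable (fun q : ℝ × ℝ => |q.2 - m|) := by fun_prop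
  have a3 : Measurable (fun q : ℝ × ℝ => C * |q.1| ^ (1 + 2 * α)) := by fun_prop
  exact (measurableSet_lt a1 measurable_const).inter
    ((measurableSet_le a2 a3).union (measurableSet_le a4 a3))

lemma near_lint {α C : ℝ} (hα : 0 < α) (hα2 : α < 1 / 2) (hC : 0 < C) :
    ∃ K : ℝ, 0 < K ∧ ∀ m : ℝ, 0 < m →
      ∫⁻ q in Nset α C m, ‖KF α m q‖ₑ ≤ ENNReal.ofReal (K * m) := by
  obtain ⟨J, hJ0, hJ⟩ := near_one_dim hα
  set K1 := 36 * C + 12 * C ^ 2 with hK1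
  have hK1p : 0 < K1 := by positivity
  refine ⟨K1 * (π + J), by positivity, fun m hm => ?_⟩
  refine le_trans ?_ (hJ K1 m hK1p hm)
  rw [← lintegral_indicator (Nset_meas α C m), Measure.volume_eq_prod, lintegral_prod _
    (((KF_meas α m).enorm.indicator (Nset_meas α C m)).aemeasurable),
    ← lintegral_indicator measurableSet_Ioo]
  apply lintegral_mono
  intro s
  by_cases hs1 : s ∈ Ioo (-1 : ℝ) 1
  swap
  · have : ∀ p, (Nset α C m).indicator (fun q => ‖KF α m q‖ₑ) (s, p) = 0 := by
      intro p
      apply indicator_of_notMem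
      rintro ⟨h, -⟩
      exact hs1 (abs_lt.1 h)
    simp [this]
  rw [indicator_of_mem hs1]
  by_cases hs : s = 0
  · have : ∀ p, (Nset α C m).indicator (fun q => ‖KF α m q‖ₑ) (s, p) = 0 := by
      intro p
      apply indicator_apply_eq_zero.2
      intro _
      simp [KF, hs]
    simp [this]
  set A := C * |s| ^ (1 + 2 * α) with hA
  have hA0 : 0 < A := by have := abs_pos.2 hs; positivity
  set B := K1 * (m ^ 2 / (m ^ 2 + s ^ 2) + m * |s| ^ (2 * α - 1)) with hB
  have hB0 : 0 ≤ B := by positivity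
  have hle : ∀ p, (Nset α C m).indicator (fun q => ‖KF α m q‖ₑ) (s, p) ≤
      (Icc (-A) A ∪ Icc (m - A) (m + A)).indicator (fun _ => ENNReal.ofReal (B / (4 * A))) p := by
    intro p
    by_cases hp : (s, p) ∈ Nset α C m
    · have hp2 := hp.2
      simp only at hp2
      rw [indicator_of_mem hp, indicator_of_mem]
      · rw [Real.enorm_eq_ofReal_abs]
        apply ENNReal.ofReal_le_ofReal
        have := KF_near hα hα2 hC hm hs hp2
        rw [hA, ← mul_assoc]
        exact this
      · rcases hp2 with h | h
        · left; exact abs_le.1 h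
        · right
          have := abs_le.1 h
          constructor <;> linarith [this.1, this.2]
    · rw [indicator_of_notMem hp]; exact zero_le
  calc _ ≤ ∫⁻ p, (Icc (-A) A ∪ Icc (m - A) (m + A)).indicator (fun _ => ENNReal.ofReal (B / (4 * A))) p :=
        lintegral_mono hle
    _ = ENNReal.ofReal (B / (4 * A)) * volume (Icc (-A) A ∪ Icc (m - A) (m + A)) := by
        rw [lintegral_indicator (measurableSet_Icc.union measurableSet_Icc), setLIntegral_const]
    _ ≤ ENNReal.ofReal (B / (4 * A)) * ENNReal.ofReal (4 * A) := by
        gcongr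
        refine (measure_union_le _ _).trans ?_
        rw [Real.volume_Icc, Real.volume_Icc, ← ENNReal.ofReal_add (by linarith) (by linarith)]
        apply ENNReal.ofReal_le_ofReal; linarith
    _ = ENNReal.ofReal B := by
        rw [← ENNReal.ofReal_mul (by positivity), div_mul_cancel₀ _ (by positivity)]

lemma far_lint {α R : ℝ} (hα : 0 < α) (hα2 : α < 1 / 2) (hR : 0 < R) :
    ∃ K : ℝ, 0 < K ∧ ∀ m : ℝ, 0 < m → m ≤ R / 2 →
      ∫⁻ q in {q : ℝ × ℝ | R ^ 2 ≤ q.1 ^ 2 + q.2 ^ 2}, ‖KF α m q‖ₑ ≤ ENNReal.ofReal (K * m) := by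
  have hI : Integrable (fun q : ℝ × ℝ => (1 + ‖q‖) ^ (-(2 + 2 * α))) :=
    integrable_one_add_norm (by simp; linarith)
  set J := ∫ q : ℝ × ℝ, (1 + ‖q‖) ^ (-(2 + 2 * α)) with hJ
  have hJ0 : 0 ≤ J := integral_nonneg fun q => by positivity
  set c := 384 * (1 + 1 / R) ^ (2 + 2 * α) with hc
  have hc0 : 0 < c := by positivity
  refine ⟨c * (J + 1), by positivity, fun m hm hmR => ?_⟩
  have hmeas : MeasurableSet {q : ℝ × ℝ | R ^ 2 ≤ q.1 ^ 2 + q.2 ^ 2} :=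
    measurableSet_le measurable_const (by fun_prop)
  calc _ ≤ ∫⁻ q in {q : ℝ × ℝ | R ^ 2 ≤ q.1 ^ 2 + q.2 ^ 2},
          ENNReal.ofReal (c * m * (1 + ‖q‖) ^ (-(2 + 2 * α))) := by
        apply setLIntegral_mono' hmeas
        rintro ⟨s, p⟩ hq
        rw [Real.enorm_eq_ofReal_abs]
        exact ENNReal.ofReal_le_ofReal (KF_far hα hα2 hR hm hmR hq)
    _ ≤ ∫⁻ q : ℝ × ℝ, ENNReal.ofReal (c * m * (1 + ‖q‖) ^ (-(2 + 2 * α))) :=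
        setLIntegral_le_lintegral _ _
    _ = ENNReal.ofReal (∫ q : ℝ × ℝ, c * m * (1 + ‖q‖) ^ (-(2 + 2 * α))) := by
        rw [ofReal_integral_eq_lintegral_ofReal (hI.const_mul _)]
        exact Eventually.of_forall fun s => by positivity
    _ ≤ _ := by
        apply ENNReal.ofReal_le_ofReal
        rw [integral_const_mul]
        nlinarith [mul_pos hc0 hm]

theorem lemV {α C R : ℝ} (hα : 0 < α) (hα2 : α < 1 / 2) (hC : 0 < C) (hR : 0 < R) (hR1 : R ≤ 1) :
    ∃ K : ℝ, 0 < K ∧ ∀ m : ℝ, 0 < m → m ≤ R / 2 → ∀ S : Set (ℝ × ℝ), MeasurableSet S →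
      IntegrableOn (KF α m) S →
      (∀ s p : ℝ, s ^ 2 + p ^ 2 < R ^ 2 → C * |s| ^ (1 + 2 * α) < |p| →
        C * |s| ^ (1 + 2 * α) < |p - m| → ((s, p) ∈ S ↔ (-s, p) ∈ S)) →
      |∫ q in S, KF α m q| ≤ K * m := by
  obtain ⟨K1, hK1, h1⟩ := near_lint hα hα2 hC
  obtain ⟨K2, hK2, h2⟩ := far_lint hα hα2 hR
  refine ⟨K1 + K2, by positivity, fun m hm hmR S hS hI hsym => ?_⟩
  set ρ : ℝ × ℝ → ℝ × ℝ := fun q => (-q.1, q.2) with hρ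
  have hmp : MeasurePreserving ρ volume volume := by
    have := (Measure.measurePreserving_neg (volume : Measure ℝ)).prod
      (MeasurePreserving.id (volume : Measure ℝ))
    exact this
  have hinv : ∀ q, ρ (ρ q) = q := by intro q; simp [hρ]
  have hemb : MeasurableEmbedding ρ :=
    (MeasurableEquiv.mk ⟨ρ, ρ, hinv, hinv⟩ hmp.measurable hmp.measurable).measurableEmbedding
  have hodd : ∀ q, KF α m (ρ q) = - KF α m q := by intro q; simp [KF, hρ]
  have hSm : MeasurableSet (ρ ⁻¹' S) := hmp.measurable hS
  rw [← integral_inter_add_sdiff hSm hI]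
  have hz : ∫ q in S ∩ ρ ⁻¹' S, KF α m q = 0 := by
    have := hmp.setIntegral_preimage_emb hemb (KF α m) (S ∩ ρ ⁻¹' S)
    have e : ρ ⁻¹' (S ∩ ρ ⁻¹' S) = S ∩ ρ ⁻¹' S := by
      ext q; simp only [mem_inter_iff, mem_preimage, hinv]; tauto
    rw [e] at this
    simp_rw [hodd] at this
    rw [integral_neg] at this
    linarith
  rw [hz, zero_add]
  set D := S \ ρ ⁻¹' S
  have hD : D ⊆ Nset α C m ∪ {q : ℝ × ℝ | R ^ 2 ≤ q.1 ^ 2 + q.2 ^ 2} := by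
    rintro ⟨s, p⟩ ⟨hq1, hq2⟩
    by_contra hcon
    rw [mem_union, not_or] at hcon
    obtain ⟨hc1, hc2⟩ := hcon
    simp only [mem_ofPred_eq, not_le] at hc2
    have hs1 : |s| < 1 := by
      rw [← sq_lt_one_iff_abs_lt_one]
      nlinarith [sq_nonneg p]
    simp only [Nset, mem_ofPred_eq, not_and, not_or, not_le] at hc1
    have := hc1 hs1
    exact hq2 ((hsym s p hc2 this.1 this.2).1 hq1)
  have hfin : ‖∫ q in D, KF α m q‖ₑ ≤ ENNReal.ofReal ((K1 + K2) * m) := by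
    refine (enorm_integral_le_lintegral_enorm _).trans ?_
    refine (lintegral_mono_set hD).trans ?_
    refine (lintegral_union_le _ _ _).trans ?_
    rw [add_mul, ENNReal.ofReal_add (by positivity) (by positivity)]
    exact add_le_add (h1 m hm) (h2 m hm hmR)
  rw [Real.enorm_eq_ofReal_abs] at hfin
  exact (ENNReal.ofReal_le_ofReal_iff (by positivity)).1 hfin



/-- adapted coordinates -/
def Phi (y n : R2) (q : ℝ × ℝ) : R2 := y + (q.1 • perp n + q.2 • n)

lemma inner_perp_self (n : R2) : inner ℝ (perp n) n = 0 := by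
  rw [inner2, perp_zero, perp_one]; ring

lemma inner_self_one {n : R2} (hn : ‖n‖ = 1) : inner ℝ n n = (1 : ℝ) := by
  rw [real_inner_self_eq_norm_sq, hn]; norm_num

lemma inner_perp_one {n : R2} (hn : ‖n‖ = 1) : inner ℝ (perp n) (perp n) = (1 : ℝ) := by
  rw [real_inner_self_eq_norm_sq, norm_perp, hn]; norm_num

lemma Phi_s (y : R2) {n : R2} (hn : ‖n‖ = 1) (q : ℝ × ℝ) : inner ℝ (Phi y n q - y) (perp n) = q.1 := by
  unfold Phi
  rw [add_sub_cancel_left, inner_add_left, real_inner_smul_left, real_inner_smul_left,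
    inner_perp_one hn, real_inner_comm, inner_perp_self]
  ring

lemma Phi_p (y : R2) {n : R2} (hn : ‖n‖ = 1) (q : ℝ × ℝ) : inner ℝ (Phi y n q - y) n = q.2 := by
  unfold Phi
  rw [add_sub_cancel_left, inner_add_left, real_inner_smul_left, real_inner_smul_left,
    inner_self_one hn, inner_perp_self]
  ring

lemma normsq_dec {n : R2} (hn : ‖n‖ = 1) (v : R2) :
    ‖v‖ ^ 2 = (inner ℝ v (perp n)) ^ 2 + (inner ℝ v n) ^ 2 := by
  have := normsq2 n
  rw [hn] at this
  rw [normsq2, inner2, inner2, perp_zero, perp_one]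
  linear_combination (-(v 0 ^ 2 + v 1 ^ 2)) * (-this)

lemma Phi_cont (y n : R2) : Continuous (Phi y n) := by
  unfold Phi; fun_prop

lemma Phi_inj (y : R2) {n : R2} (hn : ‖n‖ = 1) : Function.Injective (Phi y n) := by
  intro q q' h
  ext
  · rw [← Phi_s y hn q, ← Phi_s y hn q', h]
  · rw [← Phi_p y hn q, ← Phi_p y hn q', h]

lemma Phi_mp (y : R2) {n : R2} (hn : ‖n‖ = 1) : MeasurePreserving (Phi y n) volume volume := by
  have hon : Orthonormal ℝ ![perp n, n] := by
    rw [orthonormal_iff_ite]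
    intro i j
    fin_cases i <;> fin_cases j
    · simpa using inner_perp_one hn
    · simpa using inner_perp_self n
    · simpa [real_inner_comm] using inner_perp_self n
    · simpa using inner_self_one hn
  let b : OrthonormalBasis (Fin 2) ℝ R2 := OrthonormalBasis.mk hon
    (hon.linearIndependent.span_eq_top_of_card_eq_finrank (by simp)).ge
  have h1 := b.measurePreserving_repr_symm.comp
    ((PiLp.volume_preserving_toLp (Fin 2)).comp (volume_preserving_finTwoArrow ℝ).symm)
  have h2 := (measurePreserving_add_left (volume : Measure R2) y).comp h1
  have e : Phi y n = (fun x => y + x) ∘ b.repr.symm ∘ (WithLp.toLp 2) ∘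
      (MeasurableEquiv.finTwoArrow (α := ℝ)).symm := by
    ext1 q
    simp only [Function.comp, Phi]
    rw [← b.sum_repr_symm, Fin.sum_univ_two]
    simp [b]
  rw [e]; exact h2

lemma Phi_emb (y : R2) {n : R2} (hn : ‖n‖ = 1) : MeasurableEmbedding (Phi y n) :=
  (Phi_cont y n).measurableEmbedding (Phi_inj y hn)

lemma kern_meas (α : ℝ) : Measurable (kern α) := by
  unfold kern
  have := perp_cont.measurable
  fun_prop

lemma kern_norm {α : ℝ} (w : R2) (hα : 0 < α) : ‖kern α w‖ ≤ 1 * ‖w‖ ^ (-(1 + 2 * α)) := by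
  unfold kern
  rw [norm_smul, norm_perp, norm_inv, Real.norm_eq_abs, abs_of_nonneg (by positivity), one_mul]
  rcases eq_or_ne w 0 with rfl | hw
  · simp; positivity
  have := norm_pos_iff.2 hw
  rw [← Real.rpow_neg this.le, mul_comm, ← Real.rpow_one_add' this.le (by linarith)]
  apply le_of_eq; congr 1; ring

lemma kern_int_ball {α : ℝ} (hα : 0 < α) (hα2 : α < 1 / 2) (r : ℝ) :
    Integrable ((Metric.ball (0 : R2) r).indicator (kern α)) := by
  rw [integrable_indicator_iff measurableSet_ball]
  exact integrableOn_ball_of_norm_le_rpow (C := 1) (α := 1 + 2 * α) (by simp)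
    (by simp; linarith) (Eventually.of_forall fun x => kern_norm x hα)
    (kern_meas α).aestronglyMeasurable

lemma kern_int_bd {α : ℝ} (hα : 0 < α) (hα2 : α < 1 / 2) {S Ω : Set R2} (hS : Bornology.IsBounded S)
    (hΩ : Bornology.IsBounded Ω) (hΩm : MeasurableSet Ω) :
    ∃ B : ℝ, ∀ x ∈ S, IntegrableOn (fun q => kern α (x - q)) Ω ∧ ‖∫ q in Ω, kern α (x - q)‖ ≤ B := by
  obtain ⟨r1, h1⟩ := hS.subset_ball 0
  obtain ⟨r2, h2⟩ := hΩ.subset_ball 0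
  have hI := kern_int_ball hα hα2 (r1 + r2)
  refine ⟨∫ w, ‖(Metric.ball (0 : R2) (r1 + r2)).indicator (kern α) w‖, fun x hx => ?_⟩
  have hI2 := hI.comp_sub_left x
  have heq : EqOn (fun q => (Metric.ball (0 : R2) (r1 + r2)).indicator (kern α) (x - q))
      (fun q => kern α (x - q)) Ω := by
    intro q hq
    apply indicator_of_mem
    have a1 := mem_ball_zero_iff.1 (h1 hx)
    have a2 := mem_ball_zero_iff.1 (h2 hq)
    rw [mem_ball_zero_iff]
    exact (norm_sub_le _ _).trans_lt (by linarith)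
  refine ⟨hI2.integrableOn.congr_fun heq hΩm, ?_⟩
  rw [← setIntegral_congr_fun hΩm heq]
  refine (norm_integral_le_integral_norm _).trans ?_
  refine (setIntegral_le_integral hI2.norm (Eventually.of_forall fun _ => norm_nonneg _)).trans ?_
  rw [integral_sub_left_eq_self (fun w => ‖(Metric.ball (0 : R2) (r1 + r2)).indicator (kern α) w‖)]

lemma vel_bdd {α cα : ℝ} (hα : 0 < α) (hα2 : α < 1 / 2) {S Ω : Set R2} (hS : Bornology.IsBounded S)
    (hΩ : Bornology.IsBounded Ω) (hΩm : MeasurableSet Ω) :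
    ∃ B : ℝ, ∀ x ∈ S, ‖gSQGvel α cα Ω x‖ ≤ B := by
  obtain ⟨B, hB⟩ := kern_int_bd hα hα2 hS hΩ hΩm
  refine ⟨|cα| * B, fun x hx => ?_⟩
  unfold gSQGvel
  rw [norm_smul, Real.norm_eq_abs]
  gcongr
  exact (hB x hx).2

lemma kern_inner (α : ℝ) {n : R2} (hn : ‖n‖ = 1) (w : R2) :
    inner ℝ n (kern α w) = -(inner ℝ w (perp n)) *
      ((inner ℝ w (perp n)) ^ 2 + (inner ℝ w n) ^ 2) ^ (-(1 + α)) := by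
  rw [← normsq_dec hn]
  unfold kern
  rw [real_inner_smul_right]
  have e1 : inner ℝ n (perp w) = -inner ℝ w (perp n) := by
    rw [inner2, inner2, perp_zero, perp_one, perp_zero, perp_one]; ring
  rw [e1, ← Real.rpow_natCast, ← Real.rpow_mul (norm_nonneg _), ← Real.rpow_neg (norm_nonneg _)]
  rw [show ((2 : ℕ) : ℝ) * -(1 + α) = -(2 + 2 * α) by push_cast; ring]
  ring

theorem vel_main {α C R : ℝ} (cα : ℝ) (hα : 0 < α) (hα2 : α < 1 / 2) (hC : 0 < C) (hR : 0 < R)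
    (hR1 : R ≤ 1) :
    ∃ K : ℝ, 0 < K ∧ ∀ (Ω : Set R2) (y n : R2) (m : ℝ), IsOpen Ω → Bornology.IsBounded Ω →
      ‖n‖ = 1 → 0 < m → m ≤ R / 2 →
      (∀ q ∈ frontier Ω, ‖q - y‖ < R →
        |inner ℝ (q - y) n| ≤ C * |inner ℝ (q - y) (perp n)| ^ (1 + 2 * α) ∨
        |inner ℝ (q - y) n - m| ≤ C * |inner ℝ (q - y) (perp n)| ^ (1 + 2 * α)) →
      |inner ℝ n (gSQGvel α cα Ω (y + m • n) - gSQGvel α cα Ω y)| ≤ K * m := by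
  obtain ⟨K, hK, hV⟩ := lemV hα hα2 hC hR hR1
  refine ⟨|cα| * K + 1, by positivity, fun Ω y n m hO hB hn hm hmR hfr => ?_⟩
  have hΩm := hO.measurableSet
  set x := y + m • n with hx
  have hix : IntegrableOn (fun q => kern α (x - q)) Ω := by
    obtain ⟨B, h⟩ := kern_int_bd (S := {x}) hα hα2 Bornology.isBounded_singleton hB hΩm
    exact (h x rfl).1
  have hiy : IntegrableOn (fun q => kern α (y - q)) Ω := by
    obtain ⟨B, h⟩ := kern_int_bd (S := {y}) hα hα2 Bornology.isBounded_singleton hB hΩm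
    exact (h y rfl).1
  have hPi : ∀ q, inner ℝ n (kern α (x - Phi y n q) - kern α (y - Phi y n q)) = KF α m q := by
    intro q
    have b1 : inner ℝ (x - Phi y n q) (perp n) = -q.1 := by
      rw [show x - Phi y n q = m • n - (Phi y n q - y) by rw [hx]; abel, inner_sub_left, Phi_s y hn,
        real_inner_smul_left, real_inner_comm, inner_perp_self]; ring
    have b2 : inner ℝ (x - Phi y n q) n = m - q.2 := by
      rw [show x - Phi y n q = m • n - (Phi y n q - y) by rw [hx]; abel, inner_sub_left, Phi_p y hn,
        real_inner_smul_left, inner_self_one hn]; ring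
    have b3 : inner ℝ (y - Phi y n q) (perp n) = -q.1 := by
      rw [← neg_sub, inner_neg_left, Phi_s y hn]
    have b4 : inner ℝ (y - Phi y n q) n = -q.2 := by
      rw [← neg_sub, inner_neg_left, Phi_p y hn]
    rw [inner_sub_right, kern_inner α hn, kern_inner α hn, b1, b2, b3, b4, KF,
      show (q.2 - m) ^ 2 = (m - q.2) ^ 2 by ring]
    simp only [neg_neg, neg_sq]
    ring
  have hdiff : IntegrableOn (fun q => kern α (x - q) - kern α (y - q)) Ω := hix.sub hiy
  have hin : IntegrableOn (fun q => inner ℝ n (kern α (x - q) - kern α (y - q))) Ω :=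
    hdiff.const_inner n
  have hval : inner ℝ n (gSQGvel α cα Ω x - gSQGvel α cα Ω y) =
      cα * ∫ q in (Phi y n) ⁻¹' Ω, KF α m q := by
    unfold gSQGvel
    rw [← smul_sub, ← integral_sub hix hiy, real_inner_smul_right, ← integral_inner hdiff,
      ← (Phi_mp y hn).setIntegral_preimage_emb (Phi_emb y hn)]
    simp_rw [hPi]
  have hKI : IntegrableOn (KF α m) ((Phi y n) ⁻¹' Ω) := by
    have := ((Phi_mp y hn).integrableOn_comp_preimage (Phi_emb y hn)).2 hin
    refine this.congr_fun (fun q _ => hPi q) (Phi_cont y n |>.measurable hΩm)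
  have hfin := hV m hm hmR _ ((Phi_cont y n).measurable hΩm) hKI ?_
  · rw [hval, abs_mul]
    calc _ ≤ |cα| * (K * m) := by gcongr
      _ ≤ _ := by nlinarith
  intro s p hR2 hp1 hp2
  set I := (fun s' : ℝ => Phi y n (s', p)) '' Icc (-|s|) |s| with hI
  have hIc : IsPreconnected I :=
    isPreconnected_Icc.image _ (((Phi_cont y n).comp (by fun_prop)).continuousOn)
  have hdisj : ¬ (I ∩ frontier Ω).Nonempty := by
    rintro ⟨_, ⟨s', hs', rfl⟩, hf⟩
    have hab : |s'| ≤ |s| := abs_le.2 hs'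
    have hss : s' ^ 2 ≤ s ^ 2 := sq_le_sq.2 hab
    have h1 : C * |s'| ^ (1 + 2 * α) ≤ C * |s| ^ (1 + 2 * α) := by gcongr
    have := hfr _ hf (by
      apply lt_of_pow_lt_pow_left₀ 2 hR.le
      rw [normsq_dec hn, Phi_s y hn, Phi_p y hn]
      simp only; linarith)
    simp only at this
    rw [Phi_s y hn, Phi_p y hn] at this
    rcases this with h | h <;> linarith
  have hmem : ∀ s' ∈ Icc (-|s|) |s|, ∀ s'' ∈ Icc (-|s|) |s|, Phi y n (s', p) ∈ Ω → Phi y n (s'', p) ∈ Ω := by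
    intro s' h' s'' h'' hin1
    by_contra hout
    have hcl : ∀ q ∈ I, q ∉ Ω → q ∈ (closure Ω)ᶜ := by
      intro q hq hq2 hq3
      exact hdisj ⟨q, hq, by rw [hO.frontier_eq]; exact ⟨hq3, hq2⟩⟩
    obtain ⟨q, _, h3, h4⟩ := hIc Ω (closure Ω)ᶜ hO isClosed_closure.isOpen_compl
      (fun q hq => by by_cases h : q ∈ Ω; exacts [Or.inl h, Or.inr (hcl q hq h)])
      ⟨_, ⟨s', h', rfl⟩, hin1⟩ ⟨_, ⟨s'', h'', rfl⟩, hcl _ ⟨s'', h'', rfl⟩ hout⟩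
    exact h4 (subset_closure h3)
  have hs1 : s ∈ Icc (-|s|) |s| := ⟨neg_abs_le s, le_abs_self s⟩
  have hs2 : -s ∈ Icc (-|s|) |s| := ⟨by linarith [le_abs_self s], neg_le_abs s⟩
  exact ⟨hmem s hs1 _ hs2, hmem _ hs2 s hs1⟩



/-- minimal distance functional of a curve -/
def mF (δ : ℝ) (f : ℝ → R2) : ℝ := sInf {d : ℝ | ∃ ξ η : ℝ, δ ≤ distT ξ η ∧ d = ‖f ξ - f η‖}

lemma mF_le {δ : ℝ} {f : ℝ → R2} {ξ η : ℝ} (h : δ ≤ distT ξ η) : mF δ f ≤ ‖f ξ - f η‖ :=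
  csInf_le ⟨0, by rintro d ⟨a, b, _, rfl⟩; exact norm_nonneg _⟩ ⟨ξ, η, h, rfl⟩

lemma exists_rep (ξ : ℝ) : ∃ k : ℤ, ξ + 2 * π * k ∈ Icc (0 : ℝ) (2 * π) := by
  obtain ⟨k, hk, -⟩ := existsUnique_add_zsmul_mem_Ico (by positivity : (0:ℝ) < 2 * π) ξ 0
  refine ⟨k, ?_⟩
  rw [zero_add, zsmul_eq_mul, mul_comm (k : ℝ)] at hk
  exact Ico_subset_Icc_self hk

lemma mF_att {γ M M' δ : ℝ} {f : ℝ → R2} (h : GC γ M M' f) (hδ : δ ≤ π) :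
    ∃ ξ ∈ Icc (0 : ℝ) (2 * π), ∃ η ∈ Icc (0 : ℝ) (2 * π), δ ≤ distT ξ η ∧ ‖f ξ - f η‖ = mF δ f := by
  set S : Set (ℝ × ℝ) := (Icc (0 : ℝ) (2 * π) ×ˢ Icc (0 : ℝ) (2 * π)) ∩ {p | δ ≤ distT p.1 p.2} with hS
  have hSc : IsCompact S := (isCompact_Icc.prod isCompact_Icc).inter_right
    (isClosed_le continuous_const distT_cont)
  have hne : S.Nonempty := by
    refine ⟨(π, 0), ⟨⟨⟨Real.pi_pos.le, by linarith [Real.pi_pos]⟩, ⟨le_rfl, by positivity⟩⟩, ?_⟩⟩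
    change δ ≤ distT π 0
    rw [distT_pi]; exact hδ
  have hc : Continuous fun p : ℝ × ℝ => ‖f p.1 - f p.2‖ :=
    ((h.cont.comp continuous_fst).sub (h.cont.comp continuous_snd)).norm
  obtain ⟨⟨ξ, η⟩, ⟨⟨h1, h2⟩, h3⟩, h4⟩ := hSc.exists_isMinOn hne hc.continuousOn
  have h3 : δ ≤ distT ξ η := h3
  refine ⟨ξ, h1, η, h2, h3, le_antisymm ?_ (mF_le h3)⟩
  have hne2 : {d : ℝ | ∃ ξ η : ℝ, δ ≤ distT ξ η ∧ d = ‖f ξ - f η‖}.Nonempty :=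
    ⟨‖f ξ - f η‖, ξ, η, h3, rfl⟩
  refine le_csInf hne2 ?_
  rintro d ⟨a, b, hab, rfl⟩
  obtain ⟨k, hk⟩ := exists_rep a
  obtain ⟨l, hl⟩ := exists_rep b
  have := h4 (show (a + 2 * π * k, b + 2 * π * l) ∈ S from ⟨⟨hk, hl⟩, by
    change δ ≤ distT _ _
    rw [distT_shift]; exact hab⟩)
  simp only [mem_ofPred_eq, h.perz] at this
  exact this

lemma mF_pos {γ M M' δ : ℝ} {f : ℝ → R2} (h : GC γ M M' f) (hδ0 : 0 < δ) (hδ : δ ≤ π) : 0 < mF δ f := by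
  obtain ⟨ξ, -, η, -, h3, h4⟩ := mF_att h hδ
  rw [← h4, norm_pos_iff, sub_ne_zero]
  intro he
  obtain ⟨k, hk⟩ := h.injz he
  have := distT_le ξ η (-k)
  rw [hk] at this h3
  rw [show η + 2 * π * k - η + 2 * π * ((-k : ℤ) : ℝ) = 0 by push_cast; ring, abs_zero] at this
  linarith

section
variable {γ M M' δ : ℝ} {f : ℝ → R2}

lemma tay_small (h : GC γ M M' f) (hγ : 0 < γ) (hM : 0 < M) (hδ0 : 0 < δ)
    (hδ : M * δ ^ γ = M' / 4) {ξ η : ℝ} (hd : |η - ξ| ≤ δ) :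
    ‖f η - f ξ - (η - ξ) • deriv f ξ‖ ≤ M' / 4 * |η - ξ| := by
  refine (h.taylor' hγ.le hM.le ξ η).trans ?_
  rw [← hδ]
  gcongr

lemma sep (h : GC γ M M' f) (hγ : 0 < γ) (hM : 0 < M) (hδ0 : 0 < δ)
    (hδ : M * δ ^ γ = M' / 4) {ξ η : ℝ} (hd : |η - ξ| ≤ δ) :
    3 / 4 * M' * |η - ξ| ≤ ‖f η - f ξ‖ := by
  have h1 := tay_small h hγ hM hδ0 hδ hd
  have h2 : M' * |η - ξ| ≤ ‖(η - ξ) • deriv f ξ‖ := by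
    rw [norm_smul, Real.norm_eq_abs, mul_comm]
    gcongr
    exact h.low ξ
  have h3 := norm_sub_norm_le ((η - ξ) • deriv f ξ) (f η - f ξ)
  rw [norm_sub_rev _ (f η - f ξ)] at h3
  linarith

lemma loc (h : GC γ M M' f) (hγ : 0 < γ) (hM : 0 < M) (hM' : 0 < M') (hδ0 : 0 < δ)
    (hδ : M * δ ^ γ = M' / 4) {η ζ : ℝ} (hd : |ζ - η| ≤ δ) {n : R2} (hn : ‖n‖ = 1)
    (hperp : inner ℝ (deriv f η) n = 0) :
    |inner ℝ (f ζ - f η) n| ≤ M * (2 / M') ^ (1 + γ) * |inner ℝ (f ζ - f η) (perp n)| ^ (1 + γ) := by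
  have e : inner ℝ (f ζ - f η) n = inner ℝ (f ζ - f η - (ζ - η) • deriv f η) n := by
    rw [inner_sub_left _ ((ζ - η) • deriv f η), real_inner_smul_left, hperp]; ring
  have h1 : |inner ℝ (f ζ - f η) n| ≤ M * |ζ - η| ^ γ * |ζ - η| := by
    rw [e]
    refine (abs_real_inner_le_norm _ _).trans ?_
    rw [hn, mul_one]
    exact h.taylor' hγ.le hM.le η ζ
  have h2 : |inner ℝ (f ζ - f η) n| ≤ M' / 4 * |ζ - η| := by
    rw [e]
    refine (abs_real_inner_le_norm _ _).trans ?_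
    rw [hn, mul_one]
    exact tay_small h hγ hM hδ0 hδ hd
  have h3 := sep h hγ hM hδ0 hδ hd
  have h4 := normsq_dec hn (f ζ - f η)
  set s := inner ℝ (f ζ - f η) (perp n)
  set p := inner ℝ (f ζ - f η) n
  set d := |ζ - η| with hdd
  have hd0 : 0 ≤ d := abs_nonneg _
  have h5 : M' / 2 * d ≤ |s| := by
    apply abs_le_of_sq_le_sq' .. |>.2
    · rw [sq_abs]
      have a1 : p ^ 2 ≤ (M' / 4 * d) ^ 2 := by
        rw [← sq_abs]; gcongr
      have a2 : (3 / 4 * M' * d) ^ 2 ≤ ‖f ζ - f η‖ ^ 2 := by gcongr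
      nlinarith [sq_nonneg (M' * d)]
    · exact abs_nonneg _
  have h6 : d ≤ 2 / M' * |s| := by
    rw [div_mul_eq_mul_div, le_div_iff₀ hM']; linarith
  calc |p| ≤ M * d ^ γ * d := h1
    _ = M * d ^ (1 + γ) := by rw [Real.rpow_one_add' hd0 (by linarith)]; ring
    _ ≤ M * (2 / M' * |s|) ^ (1 + γ) := by gcongr
    _ = _ := by rw [Real.mul_rpow (by positivity) (abs_nonneg _)]; ring

lemma crit (h : GC γ M M' f) {ξ η : ℝ} (hd : δ < distT ξ η) (hm : ‖f ξ - f η‖ = mF δ f) :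
    inner ℝ (deriv f ξ) (f ξ - f η) = 0 := by
  have h1 : IsLocalMin (fun s => ‖f s - f η‖ ^ 2) ξ := by
    have hc : Continuous fun s => distT s η := distT_cont.comp (by fun_prop : Continuous fun s : ℝ => (s, η))
    filter_upwards [hc.continuousAt.eventually (lt_mem_nhds hd)] with s hs
    have : ‖f ξ - f η‖ ≤ ‖f s - f η‖ := by rw [hm]; exact mF_le hs.le
    gcongr
  have h2 := ((h.hasDeriv ξ).sub_const (f η)).norm_sq
  have h3 := h1.hasDerivAt_eq_zero h2
  rw [real_inner_comm]
  linarith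

end

theorem geom {α γ M M' δ R : ℝ} (cα : ℝ) (hα : 0 < α) (hα2 : α < 1 / 2) (hγ : 2 * α ≤ γ)
    (hM : 0 < M) (hM' : 0 < M') (hδ0 : 0 < δ) (hδ : M * δ ^ γ = M' / 4) (hR : 0 < R) :
    ∃ K ε₀ : ℝ, 0 < K ∧ 0 < ε₀ ∧ ∀ (Ω : Set R2) (f : ℝ → R2), GC γ M M' f → IsOpen Ω →
      Bornology.IsBounded Ω → frontier Ω ⊆ range f → ∀ ξ η, δ ≤ distT ξ η →
      ‖f ξ - f η‖ = mF δ f → 0 < mF δ f → mF δ f < ε₀ →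
      (∀ ζ, δ ≤ distT ζ ξ → δ ≤ distT ζ η → R < ‖f ζ - f η‖) →
      δ < distT ξ η ∧
      |inner ℝ (f ξ - f η) (gSQGvel α cα Ω (f ξ) - gSQGvel α cα Ω (f η))| ≤ K * mF δ f ^ 2 := by
  have hγ0 : 0 < γ := by linarith
  set C := M * (2 / M') ^ (1 + γ) with hC
  have hC0 : 0 < C := by positivity
  set R1 := min R 1 with hR1
  have hR10 : 0 < R1 := lt_min hR one_pos
  obtain ⟨K, hK, hV⟩ := vel_main cα hα hα2 hC0 hR10 (min_le_right _ _)
  refine ⟨K, min (R1 / 2) (3 / 4 * M' * δ), hK, lt_min (by positivity) (by positivity), ?_⟩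
  intro Ω f h hO hB hfr ξ η hξη hmin hpos hsm hsimp
  set m := mF δ f with hm
  have hm1 : m < R1 / 2 := hsm.trans_le (min_le_left _ _)
  have hm2 : m < 3 / 4 * M' * δ := hsm.trans_le (min_le_right _ _)
  have hlt : δ < distT ξ η := by
    refine lt_of_le_of_ne hξη fun he => ?_
    obtain ⟨k, hk⟩ := distT_exists ξ η
    have h1 : |ξ + 2 * π * k - η| = δ := by rw [he, hk]; congr 1; ring
    have h2 := sep h hγ0 hM hδ0 hδ h1.le
    rw [h1, h.perz, hmin] at h2
    linarith
  refine ⟨hlt, ?_⟩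
  have c1 := crit h hlt hmin
  have c2 := crit h (ξ := η) (η := ξ) (by rw [distT_comm]; exact hlt) (by rw [norm_sub_rev]; exact hmin)
  set n := m⁻¹ • (f ξ - f η) with hn
  have hn1 : ‖n‖ = 1 := by
    rw [hn, norm_smul, hmin, norm_inv, Real.norm_eq_abs, abs_of_pos hpos, inv_mul_cancel₀ hpos.ne']
  have hmn : m • n = f ξ - f η := by
    rw [hn, smul_smul, mul_inv_cancel₀ hpos.ne', one_smul]
  have p1 : inner ℝ (deriv f ξ) n = 0 := by rw [hn, real_inner_smul_right, c1, mul_zero]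
  have p2 : inner ℝ (deriv f η) n = 0 := by
    rw [hn, real_inner_smul_right, ← neg_sub, inner_neg_right, c2]; simp
  have hfin := hV Ω (f η) n m hO hB hn1 hpos hm1.le ?_
  · rw [show f η + m • n = f ξ by rw [hmn]; abel] at hfin
    rw [← hmn, real_inner_smul_left, abs_mul, abs_of_pos hpos]
    nlinarith
  intro q hq hqR
  obtain ⟨ζ, rfl⟩ := hfr hq
  have hs1 : |inner ℝ (f ζ - f η) (perp n)| ≤ 1 := by
    refine (abs_real_inner_le_norm _ _).trans ?_
    rw [norm_perp, hn1, mul_one]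
    exact hqR.le.trans (min_le_right _ _)
  have hpow : C * |inner ℝ (f ζ - f η) (perp n)| ^ (1 + γ) ≤
      C * |inner ℝ (f ζ - f η) (perp n)| ^ (1 + 2 * α) := by
    gcongr C * ?_
    rcases (abs_nonneg (inner ℝ (f ζ - f η) (perp n))).eq_or_lt with h0 | h0
    · rw [← h0, Real.zero_rpow (by linarith), Real.zero_rpow (by linarith)]
    · exact Real.rpow_le_rpow_of_exponent_ge h0 hs1 (by linarith)
  by_cases hA : δ ≤ distT ζ η
  · right
    have hB : ¬ δ ≤ distT ζ ξ := fun hB => by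
      have := hsimp ζ hB hA
      have := min_le_left R 1
      linarith
    push Not at hB
    obtain ⟨k, hk⟩ := distT_exists ζ ξ
    have h1 : |ζ + 2 * π * k - ξ| ≤ δ := by
      rw [show ζ + 2 * π * k - ξ = ζ - ξ + 2 * π * k by ring, ← hk]; exact hB.le
    have h2 := loc h hγ0 hM hM' hδ0 hδ h1 hn1 p1
    rw [h.perz] at h2
    have e1 : f ζ - f ξ = (f ζ - f η) - m • n := by rw [hmn]; abel
    have e2 : inner ℝ (f ζ - f ξ) n = inner ℝ (f ζ - f η) n - m := by
      rw [e1, inner_sub_left, real_inner_smul_left, inner_self_one hn1, mul_one]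
    have e3 : inner ℝ (f ζ - f ξ) (perp n) = inner ℝ (f ζ - f η) (perp n) := by
      rw [e1, inner_sub_left, real_inner_smul_left, real_inner_comm _ n, inner_perp_self]; ring
    rw [e2, e3] at h2
    exact h2.trans hpow
  · left
    push Not at hA
    obtain ⟨k, hk⟩ := distT_exists ζ η
    have h1 : |ζ + 2 * π * k - η| ≤ δ := by
      rw [show ζ + 2 * π * k - η = ζ - η + 2 * π * k by ring, ← hk]; exact hA.le
    have h2 := loc h hγ0 hM hM' hδ0 hδ h1 hn1 p2
    rw [h.perz] at h2
    exact h2.trans hpow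



section
variable {ι : Type*} {γ M M' δ : ℝ} {f : ℝ → R2}

lemma ultra_pt (U : Ultrafilter ι) (F : ι → ℝ → R2) (hγ : 0 < γ) (hM' : 0 < M') (hM : 0 < M)
    (hF : ∀ᶠ i in (U : Filter ι), GC γ M M' (F i)) (h : GC γ M M' f)
    (hH : ∀ ε > 0, ∀ᶠ i in (U : Filter ι), ∀ ξ, ∃ ζ, ‖F i ξ - f ζ‖ < ε) (ξ η : ι → ℝ) :
    ∃ ξs ηs, Tendsto (fun i => distT (ξ i) (η i)) U (𝓝 (distT ξs ηs)) ∧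
      Tendsto (fun i => F i (ξ i)) U (𝓝 (f ξs)) ∧ Tendsto (fun i => F i (η i)) U (𝓝 (f ηs)) := by
  obtain ⟨a, κ, hκ, hlim⟩ := GC.ultralimit U F hγ hM' hM hF h hH
  have key : ∀ ξ : ι → ℝ, ∃ ξ' : ι → ℝ, (∀ i, ∃ k : ℤ, ξ' i = ξ i + 2 * π * k) ∧
      ∃ x, Tendsto ξ' U (𝓝 x) ∧ Tendsto (fun i => F i (ξ i)) U (𝓝 (f (a + κ * x))) := by
    intro ξ
    choose k hk using fun i => exists_rep (ξ i)
    refine ⟨fun i => ξ i + 2 * π * k i, fun i => ⟨k i, rfl⟩, ?_⟩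
    obtain ⟨x, -, hx⟩ := isCompact_Icc.ultrafilter_le_nhds (U.map fun i => ξ i + 2 * π * k i)
      (by
        rw [le_principal_iff]
        exact mem_map.2 (univ_mem' hk))
    have hx : Tendsto (fun i => ξ i + 2 * π * k i) U (𝓝 x) := hx
    refine ⟨x, hx, ?_⟩
    have h1 : Tendsto (fun i => F i (ξ i) - F i x) U (𝓝 0) := by
      rw [tendsto_zero_iff_norm_tendsto_zero]
      have h2 : Tendsto (fun i => M * |ξ i + 2 * π * k i - x|) U (𝓝 0) := by
        have := ((hx.sub_const x).abs).const_mul M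
        simpa using this
      refine tendsto_of_tendsto_of_tendsto_of_le_of_le' tendsto_const_nhds h2
        (Eventually.of_forall fun _ => norm_nonneg _) ?_
      filter_upwards [hF] with i hi
      rw [← hi.perz (ξ i) (k i)]
      exact hi.lip _ _
    have := h1.add (hlim x)
    simpa using this
  obtain ⟨ξ', h1, x, h2, h3⟩ := key ξ
  obtain ⟨η', h4, y, h5, h6⟩ := key η
  refine ⟨a + κ * x, a + κ * y, ?_, h3, h6⟩
  rw [distT_neg _ _ _ _ hκ]
  have e : ∀ i, distT (ξ i) (η i) = distT (ξ' i) (η' i) := by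
    intro i
    obtain ⟨k, hk⟩ := h1 i
    obtain ⟨l, hl⟩ := h4 i
    rw [hk, hl, distT_shift]
  simp_rw [e]
  have hc : Tendsto (fun p : ℝ × ℝ => distT p.1 p.2) (𝓝 (x, y)) (𝓝 (distT x y)) :=
    distT_cont.continuousAt
  exact Tendsto.comp (g := fun p : ℝ × ℝ => distT p.1 p.2) (f := fun i => (ξ' i, η' i)) hc
    (h2.prodMk_nhds h5)

lemma mF_lsc (l : Filter ι) (F : ι → ℝ → R2) (hγ : 0 < γ) (hM' : 0 < M') (hM : 0 < M) (hδ : δ ≤ π)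
    (hF : ∀ᶠ i in l, GC γ M M' (F i)) (h : GC γ M M' f)
    (hH : ∀ ε > 0, ∀ᶠ i in l, ∀ ξ, ∃ ζ, ‖F i ξ - f ζ‖ < ε) {c : ℝ} (hc : c < mF δ f) :
    ∀ᶠ i in l, c < mF δ (F i) := by
  by_contra hcon
  rw [not_eventually] at hcon
  have : (l ⊓ 𝓟 {i | ¬ c < mF δ (F i)}).NeBot := frequently_mem_iff_neBot.1 hcon
  set U := Ultrafilter.of (l ⊓ 𝓟 {i | ¬ c < mF δ (F i)}) with hU
  have hUl : (U : Filter ι) ≤ l := (Ultrafilter.of_le _).trans inf_le_left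
  have hUb : ∀ᶠ i in (U : Filter ι), ¬ c < mF δ (F i) :=
    ((Ultrafilter.of_le _).trans inf_le_right) (mem_principal_self _)
  have hatt : ∀ᶠ i in (U : Filter ι), ∃ p : ℝ × ℝ, δ ≤ distT p.1 p.2 ∧ ‖F i p.1 - F i p.2‖ = mF δ (F i) := by
    filter_upwards [hUl hF] with i hi
    obtain ⟨ξ, -, η, -, h1, h2⟩ := mF_att hi hδ
    exact ⟨(ξ, η), h1, h2⟩
  obtain ⟨p, hp⟩ := hatt.choice
  obtain ⟨ξs, ηs, h1, h2, h3⟩ := ultra_pt U F hγ hM' hM (hUl hF) h (fun ε hε => hUl (hH ε hε))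
    (fun i => (p i).1) (fun i => (p i).2)
  have h4 : δ ≤ distT ξs ηs := ge_of_tendsto h1 (hp.mono fun i hi => hi.1)
  have h5 : ‖f ξs - f ηs‖ ≤ c := by
    refine le_of_tendsto (h2.sub h3).norm ?_
    filter_upwards [hp, hUb] with i hi hi2
    rw [hi.2]; exact not_lt.1 hi2
  linarith [mF_le (f := f) h4]

lemma sep_persist (l : Filter ι) (F : ι → ℝ → R2) (hγ : 0 < γ) (hM' : 0 < M') (hM : 0 < M)
    (hF : ∀ᶠ i in l, GC γ M M' (F i)) (h : GC γ M M' f)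
    (hH : ∀ ε > 0, ∀ᶠ i in l, ∀ ξ, ∃ ζ, ‖F i ξ - f ζ‖ < ε) {ξ η : ℝ} (hd : δ < distT ξ η)
    {ξ' η' : ι → ℝ} (h1 : Tendsto (fun i => F i (ξ' i)) l (𝓝 (f ξ)))
    (h2 : Tendsto (fun i => F i (η' i)) l (𝓝 (f η))) : ∀ᶠ i in l, δ ≤ distT (ξ' i) (η' i) := by
  by_contra hcon
  rw [not_eventually] at hcon
  have : (l ⊓ 𝓟 {i | ¬ δ ≤ distT (ξ' i) (η' i)}).NeBot := frequently_mem_iff_neBot.1 hcon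
  set U := Ultrafilter.of (l ⊓ 𝓟 {i | ¬ δ ≤ distT (ξ' i) (η' i)}) with hU
  have hUl : (U : Filter ι) ≤ l := (Ultrafilter.of_le _).trans inf_le_left
  have hUb : ∀ᶠ i in (U : Filter ι), ¬ δ ≤ distT (ξ' i) (η' i) :=
    ((Ultrafilter.of_le _).trans inf_le_right) (mem_principal_self _)
  obtain ⟨ξs, ηs, k1, k2, k3⟩ := ultra_pt U F hγ hM' hM (hUl hF) h (fun ε hε => hUl (hH ε hε)) ξ' η'
  obtain ⟨k, hk⟩ := h.injz (tendsto_nhds_unique k2 (h1.mono_left hUl))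
  obtain ⟨j, hj⟩ := h.injz (tendsto_nhds_unique k3 (h2.mono_left hUl))
  rw [hk, hj, distT_shift] at k1
  have : distT ξ η ≤ δ := le_of_tendsto k1 (hUb.mono fun i hi => (not_le.1 hi).le)
  linarith

/-- one-sided Dini estimate -/
lemma dini (F : ℝ → ℝ → R2) (hγ : 0 < γ) (hM' : 0 < M') (hM : 0 < M)
    (hF : ∀ᶠ i in 𝓝[>] (0 : ℝ), GC γ M M' (F i)) (h : GC γ M M' f)
    (hH : ∀ ε > 0, ∀ᶠ i in 𝓝[>] (0 : ℝ), ∀ ξ, ∃ ζ, ‖F i ξ - f ζ‖ < ε) (V : R2 → R2)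
    (hp : ∀ ξ, ∀ ε > 0, ∀ᶠ i in 𝓝[>] (0 : ℝ), ∃ ζ, ‖F i ζ - (f ξ - i • V (f ξ))‖ ≤ ε * i)
    {ξ η K m : ℝ} (hm0 : 0 < m) (hK : 0 < K) (hd : δ < distT ξ η) (hm : ‖f ξ - f η‖ = m)
    (hv : |inner ℝ (f ξ - f η) (V (f ξ) - V (f η))| ≤ K * m ^ 2) {ε : ℝ} (hε : 0 < ε) :
    ∀ᶠ i in 𝓝[>] (0 : ℝ), mF δ (F i) ≤ m * (1 + K * i) + ε * i := by
  have hi0 : Tendsto (fun i : ℝ => i) (𝓝[>] (0 : ℝ)) (𝓝 0) := nhdsWithin_le_nhds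
  have hlim : ∀ ξ (ζ : ℝ → ℝ), (∀ᶠ i in 𝓝[>] (0 : ℝ), ‖F i (ζ i) - (f ξ - i • V (f ξ))‖ ≤ ε / 4 * i) →
      Tendsto (fun i => F i (ζ i)) (𝓝[>] (0 : ℝ)) (𝓝 (f ξ)) := by
    intro ξ ζ hζ
    have a1 : Tendsto (fun i : ℝ => f ξ - i • V (f ξ)) (𝓝[>] (0 : ℝ)) (𝓝 (f ξ)) := by
      have := (tendsto_const_nhds (x := f ξ)).sub (hi0.smul_const (V (f ξ)))
      simpa using this
    have a2 : Tendsto (fun i => F i (ζ i) - (f ξ - i • V (f ξ))) (𝓝[>] (0 : ℝ)) (𝓝 0) := by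
      rw [tendsto_zero_iff_norm_tendsto_zero]
      refine tendsto_of_tendsto_of_tendsto_of_le_of_le' tendsto_const_nhds ?_
        (Eventually.of_forall fun _ => norm_nonneg _) hζ
      simpa using hi0.const_mul (ε / 4)
    simpa using a2.add a1
  obtain ⟨ζ1, h1⟩ := (hp ξ (ε / 4) (by positivity)).choice
  obtain ⟨ζ2, h2⟩ := (hp η (ε / 4) (by positivity)).choice
  have hs := sep_persist _ F hγ hM' hM hF h hH hd (hlim ξ ζ1 h1) (hlim η ζ2 h2)
  set v := V (f ξ) - V (f η) with hvdef
  have hsmall : ∀ᶠ i in 𝓝[>] (0 : ℝ), i < ε * m / (‖v‖ ^ 2 + 1) :=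
    hi0.eventually (gt_mem_nhds (by positivity))
  filter_upwards [h1, h2, hs, hsmall, self_mem_nhdsWithin] with i k1 k2 k3 k4 k5
  have hi : 0 < i := k5
  have b0 : ‖f ξ - f η - i • v‖ ≤ m * (1 + K * i) + i ^ 2 * ‖v‖ ^ 2 / (2 * m) := by
    apply le_of_sq_le_sq _ (by positivity)
    rw [norm_sub_sq_real, hm, real_inner_smul_right, norm_smul, Real.norm_eq_abs, abs_of_pos hi]
    have c1 := (abs_le.1 hv).1
    have c2 : (m * (1 + K * i) + i ^ 2 * ‖v‖ ^ 2 / (2 * m)) ^ 2 =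
        m ^ 2 + 2 * i * K * m ^ 2 + (K * i * m) ^ 2 + (1 + K * i) * (i ^ 2 * ‖v‖ ^ 2) +
          (i ^ 2 * ‖v‖ ^ 2 / (2 * m)) ^ 2 := by
      field_simp
      ring
    rw [c2]
    have c3 : 0 ≤ (K * i * m) ^ 2 := by positivity
    have c4 : 0 ≤ (i ^ 2 * ‖v‖ ^ 2 / (2 * m)) ^ 2 := by positivity
    have c5 : 0 ≤ K * i * (i ^ 2 * ‖v‖ ^ 2) := by positivity
    have c6 : -(i * inner ℝ (f ξ - f η) v) ≤ i * (K * m ^ 2) := by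
      rw [← mul_neg]; gcongr; linarith
    nlinarith
  have b1 : i ^ 2 * ‖v‖ ^ 2 / (2 * m) ≤ ε / 2 * i := by
    rw [div_le_iff₀ (by positivity)]
    rw [lt_div_iff₀ (by positivity)] at k4
    nlinarith
  have b2 : F i (ζ1 i) - F i (ζ2 i) = (f ξ - f η - i • v) + ((F i (ζ1 i) - (f ξ - i • V (f ξ))) -
      (F i (ζ2 i) - (f η - i • V (f η)))) := by
    rw [hvdef, smul_sub]; abel
  have b3 : ‖F i (ζ1 i) - F i (ζ2 i)‖ ≤ ‖f ξ - f η - i • v‖ + (ε / 4 * i + ε / 4 * i) := by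
    rw [b2]
    refine (norm_add_le _ _).trans ?_
    gcongr
    exact (norm_sub_le _ _).trans (add_le_add k1 k2)
  have b4 := mF_le (f := F i) k3
  linarith

end



lemma final_real {μ : ℝ → ℝ} {t₀ T K ε₀ : ℝ} (ht0 : 0 ≤ t₀) (htT : t₀ < T) (hK : 0 < K) (hε₀ : 0 < ε₀)
    (hpos : ∀ t ∈ Ico 0 T, 0 < μ t) (hlsc : LowerSemicontinuousOn μ (Ico 0 T))
    (hdini : ∀ t ∈ Ioo t₀ T, μ t < ε₀ → ∀ ε > 0, ∀ᶠ h in 𝓝[>] (0 : ℝ),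
      μ (t - h) ≤ μ t * (1 + K * h) + ε * h) :
    ∃ ε : ℝ, 0 < ε ∧ ∀ t ∈ Ico 0 T, ε ≤ μ t := by
  have hsub : Icc 0 t₀ ⊆ Ico 0 T := fun x hx => ⟨hx.1, hx.2.trans_lt htT⟩
  obtain ⟨a, ha, hamin⟩ := (hlsc.mono hsub).exists_isMinOn (nonempty_Icc.2 ht0) isCompact_Icc
  set b := min ε₀ (μ t₀) with hb
  have hb0 : 0 < b := lt_min hε₀ (hpos _ ⟨ht0, htT⟩)
  have hgrow : ∀ t ∈ Ioo t₀ T, b * exp (-(K * (t - t₀))) ≤ μ t := by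
    intro t ht
    by_contra hcon
    push Not at hcon
    have hE : 0 < exp (K * (t - t₀)) := exp_pos _
    have h1 : μ t * exp (K * (t - t₀)) < b := by
      calc _ < b * exp (-(K * (t - t₀))) * exp (K * (t - t₀)) := by gcongr
        _ = b := by rw [mul_assoc, ← exp_add]; simp
    have htt : 0 < t - t₀ := sub_pos.2 ht.1
    obtain ⟨ε, hε, hεb⟩ : ∃ ε > 0, (μ t + ε * (t - t₀)) * exp (K * (t - t₀)) < b := by
      refine ⟨(b - μ t * exp (K * (t - t₀))) / (2 * (t - t₀) * exp (K * (t - t₀))),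
        div_pos (by linarith) (by positivity), ?_⟩
      rw [add_mul]
      have : (b - μ t * exp (K * (t - t₀))) / (2 * (t - t₀) * exp (K * (t - t₀))) * (t - t₀) *
        exp (K * (t - t₀)) = (b - μ t * exp (K * (t - t₀))) / 2 := by field_simp
      rw [this]; linarith
    have hμt : 0 < μ t := hpos t ⟨ht0.trans ht.1.le, ht.2⟩
    set g : ℝ → ℝ := fun τ => (μ t + ε * (t - τ)) * exp (K * (t - τ)) with hg
    have hgb : ∀ τ ∈ Icc t₀ t, g τ < b := by
      intro τ hτ
      refine lt_of_le_of_lt ?_ hεb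
      have a1 : 0 ≤ t - τ := by linarith [hτ.2]
      have a2 : t - τ ≤ t - t₀ := by linarith [hτ.1]
      simp only [hg]
      gcongr
    have hgc : Continuous g := by simp only [hg]; fun_prop
    set A : Set ℝ := {τ | τ ∈ Icc t₀ t ∧ μ τ ≤ g τ} with hA
    have htA : t ∈ A := ⟨⟨ht.1.le, le_rfl⟩, by simp [hg]⟩
    have hAb : BddBelow A := ⟨t₀, fun τ hτ => hτ.1.1⟩
    set σ := sInf A with hσ
    have hglb : IsGLB A σ := isGLB_csInf ⟨t, htA⟩ hAb
    have hσ1 : σ ∈ Icc t₀ t := ⟨le_csInf ⟨t, htA⟩ fun τ hτ => hτ.1.1, csInf_le hAb htA⟩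
    have hσT : σ ∈ Ico 0 T := ⟨ht0.trans hσ1.1, hσ1.2.trans_lt ht.2⟩
    have hσA : μ σ ≤ g σ := by
      by_contra hlt
      push Not at hlt
      obtain ⟨c, hc1, hc2⟩ := exists_between hlt
      have e1 : ∀ᶠ τ in 𝓝[≥] σ, c < μ τ := by
        have hmem : Ico 0 T ∈ 𝓝[≥] σ :=
          mem_of_superset (Ico_mem_nhdsGE hσT.2) fun x hx => ⟨hσT.1.trans hx.1, hx.2⟩
        exact (nhdsWithin_le_of_mem hmem) (hlsc σ hσT c hc2)
      have e2 : ∀ᶠ τ in 𝓝[≥] σ, g τ < c :=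
        nhdsWithin_le_nhds (hgc.continuousAt.eventually (gt_mem_nhds hc1))
      obtain ⟨τ, hτ, h3, h4⟩ := ((hglb.frequently_mem ⟨t, htA⟩).and_eventually (e1.and e2)).exists
      linarith [hτ.2]
    have hσb := hgb σ hσ1
    rcases hσ1.1.eq_or_lt with he | hlt
    · have : b ≤ μ t₀ := min_le_right _ _
      rw [← he] at hσA hσb
      linarith
    · have hσε : μ σ < ε₀ := by have : b ≤ ε₀ := min_le_left _ _; linarith
      have e1 := hdini σ ⟨hlt, hσT.2⟩ hσε ε hε
      have e2 : ∀ᶠ h in 𝓝[>] (0 : ℝ), h < σ - t₀ :=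
        nhdsWithin_le_nhds (gt_mem_nhds (by linarith))
      obtain ⟨h, h3, h4, h5⟩ := (e1.and (e2.and self_mem_nhdsWithin)).exists
      have hh : 0 < h := h5
      have hmem : σ - h ∈ A := by
        refine ⟨⟨by linarith, by linarith [hσ1.2]⟩, h3.trans ?_⟩
        have q1 : 1 + K * h ≤ exp (K * h) := by linarith [add_one_le_exp (K * h)]
        have q2 : g (σ - h) = g σ * exp (K * h) + ε * h * exp (K * (t - (σ - h))) := by
          simp only [hg]
          rw [show K * (t - (σ - h)) = K * (t - σ) + K * h by ring, exp_add]; ring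
        have q3 : 1 ≤ exp (K * (t - (σ - h))) := one_le_exp (by
          have : 0 ≤ t - (σ - h) := by linarith [hσ1.2]
          positivity)
        have q4 : 0 < μ σ := hpos σ hσT
        rw [q2]
        have q5 : μ σ * (1 + K * h) ≤ g σ * exp (K * h) := by
          have q7 : 0 ≤ g σ := q4.le.trans hσA
          gcongr
        have q6 : ε * h * 1 ≤ ε * h * exp (K * (t - (σ - h))) := by gcongr
        linarith
      have := csInf_le hAb hmem
      linarith
  refine ⟨min (μ a) (b * exp (-(K * T))), lt_min (hpos a (hsub ha)) (by positivity), fun t ht => ?_⟩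
  rcases le_or_gt t t₀ with h | h
  · exact (min_le_left _ _).trans (hamin ⟨ht.1, h⟩)
  · refine (min_le_right _ _).trans (le_trans ?_ (hgrow t ⟨h, ht.2⟩))
    gcongr
    linarith [ht.2]

/-- (Subsection 2.5: absence of simple splashes for all `γ ∈ [2α,1]`) Let `α ∈ (0,1/2)` and
`γ ∈ [2α,1]`, and let `ω = χ_{Ω(t)}` be a patch solution to the g-SQG equation on `ℝ²` on
`[0,T)`, `T < ∞`, with constant-speed counterclockwise parameterizations `z(·,t)` of
`∂Ω(t)`, with `M ≥ sup_{t∈[0,T)}‖z(·,t)‖_{C^{1,γ}}` and `0 < M' ≤ inf |∂_ξ z|`.  Let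
`δ = (M'/(4M))^{1/γ}` and `m(t) = min_{|ξ−η|≥δ} |z(ξ,t) − z(η,t)|`, and assume that only
simple splashes can happen: there are `R > 0` and `t₀ ∈ [0,T)` such that for every
`t ∈ [t₀,T)`, every minimizing pair `(ξ_t,η_t)` of `m(t)`, and every `ξ` with
`min(|ξ−ξ_t|,|ξ−η_t|) ≥ δ`, one has `|z(ξ,t) − z(η_t,t)| > R`.  Then
`inf_{t∈[0,T)} m(t) > 0`: no simple splash can occur at time `T`. -/
theorem no_simple_splash
    (α γ T cα M M' δ : ℝ) (Ω : ℝ → Set R2) (z : ℝ → ℝ → R2) (m : ℝ → ℝ)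
    (hα0 : 0 < α) (hα : α < 1 / 2) (hγ1 : 2 * α ≤ γ) (hγ2 : γ ≤ 1)
    (hT : 0 < T) (hcα : 0 < cα)
    -- `Ω(t)` is a bounded open set
    (hopen : ∀ t ∈ Ico 0 T, IsOpen (Ω t))
    (hbdd : ∀ t ∈ Ico 0 T, Bornology.IsBounded (Ω t))
    -- `z(·,t)` is a simple closed `C¹` curve parameterizing `∂Ω(t)`
    (hzper : ∀ t ∈ Ico 0 T, ∀ ξ : ℝ, z (ξ + 2 * π) t = z ξ t)
    (hzinj : ∀ t ∈ Ico 0 T, InjOn (fun ξ => z ξ t) (Ico 0 (2 * π)))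
    (hzC1 : ∀ t ∈ Ico 0 T, ContDiff ℝ 1 (fun ξ => z ξ t))
    (hzim : ∀ t ∈ Ico 0 T, (fun ξ => z ξ t) '' Ico 0 (2 * π) = frontier (Ω t))
    -- with constant speed
    (hspeed : ∀ t ∈ Ico 0 T, ∃ c : ℝ, 0 < c ∧ ∀ ξ : ℝ, ‖deriv (fun ζ => z ζ t) ξ‖ = c)
    -- counterclockwise (positive signed area)
    (hccw : ∀ t ∈ Ico 0 T,
      0 < ∫ ξ in (0:ℝ)..(2 * π),
        (z ξ t 0 * (deriv (fun ζ => z ζ t) ξ) 1 - z ξ t 1 * (deriv (fun ζ => z ζ t) ξ) 0))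
    -- the boundary is continuous in time w.r.t. Hausdorff distance
    (hHaus : ∀ t₀ ∈ Ico 0 T,
      Tendsto (fun t => Metric.hausdorffDist (frontier (Ω t)) (frontier (Ω t₀)))
        (nhdsWithin t₀ (Ico 0 T)) (nhds 0))
    -- patch solution: `lim_{h→0} d_H(∂Ω(t+h), X^h_{u(·,t)}[∂Ω(t)])/h = 0`
    (hpatch : ∀ t ∈ Ioo 0 T,
      Tendsto (fun h =>
          Metric.hausdorffDist (frontier (Ω (t + h)))
            ((fun x => x + h • gSQGvel α cα (Ω t) x) '' frontier (Ω t)) / |h|)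
        (nhdsWithin 0 {h : ℝ | t + h ∈ Ico 0 T ∧ h ≠ 0}) (nhds 0))
    -- `M` bounds `sup_t ‖z(·,t)‖_{C^{1,γ}}` and `M'` bounds `|∂_ξ z|` from below
    (hM : ∀ t ∈ Ico 0 T, ∀ ξ η : ℝ,
      ‖z ξ t‖ ≤ M ∧ ‖deriv (fun ζ => z ζ t) ξ‖ ≤ M ∧
        ‖deriv (fun ζ => z ζ t) ξ - deriv (fun ζ => z ζ t) η‖ ≤ M * |ξ - η| ^ γ)
    (hM'0 : 0 < M')
    (hM' : ∀ t ∈ Ico 0 T, ∀ ξ : ℝ, M' ≤ ‖deriv (fun ζ => z ζ t) ξ‖)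
    -- `δ = (M'/(4M))^{1/γ}` and `m(t) = min_{|ξ−η|≥δ}|z(ξ,t)−z(η,t)|`
    (hδ : δ = (M' / (4 * M)) ^ (1 / γ))
    (hm : ∀ t : ℝ, m t = sInf {d : ℝ | ∃ ξ η : ℝ, δ ≤ distT ξ η ∧ d = ‖z ξ t - z η t‖})
    -- only simple splashes can happen
    (hsimple : ∃ R : ℝ, 0 < R ∧ ∃ t₀ ∈ Ico 0 T, ∀ t ∈ Ico t₀ T, ∀ ξt ηt : ℝ,
      δ ≤ distT ξt ηt → ‖z ξt t - z ηt t‖ = m t →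
        ∀ ξ : ℝ, δ ≤ distT ξ ξt → δ ≤ distT ξ ηt → R < ‖z ξ t - z ηt t‖) :
    ∃ ε : ℝ, 0 < ε ∧ ∀ t ∈ Ico 0 T, ε ≤ m t := by
  obtain ⟨R, hR, t₀, ht₀, hsimple⟩ := hsimple
  have hγ : 0 < γ := by linarith
  have h0T : (0 : ℝ) ∈ Ico 0 T := ⟨le_rfl, hT⟩
  have hMM : M' ≤ M := (hM' 0 h0T 0).trans (hM 0 h0T 0 0).2.1
  have hMp : 0 < M := hM'0.trans_le hMM
  have hδ0 : 0 < δ := by rw [hδ]; positivity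
  have hδγ : M * δ ^ γ = M' / 4 := by
    rw [hδ, ← Real.rpow_mul (by positivity), one_div, inv_mul_cancel₀ hγ.ne', Real.rpow_one]
    field_simp
  have hδπ : δ ≤ π := by
    have : δ ≤ 1 := by
      rw [hδ]
      apply Real.rpow_le_one (by positivity)
      · rw [div_le_one (by positivity)]; linarith
      · positivity
    linarith [Real.pi_gt_three]
  set F : ℝ → ℝ → R2 := fun t ξ => z ξ t with hF
  have hGC : ∀ t ∈ Ico 0 T, GC γ M M' (F t) := fun t ht =>
    { per := hzper t ht
      inj := hzinj t ht
      C1 := hzC1 t ht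
      speed := hspeed t ht
      bd := fun ξ => (hM t ht ξ ξ).1
      dbd := fun ξ => (hM t ht ξ ξ).2.1
      hol := fun ξ η => (hM t ht ξ η).2.2
      low := hM' t ht }
  have hmm : ∀ t, m t = mF δ (F t) := hm
  have hrange : ∀ t ∈ Ico 0 T, frontier (Ω t) = range (F t) := by
    intro t ht
    rw [← hzim t ht]
    apply subset_antisymm (image_subset_range _ _)
    rintro _ ⟨ξ, rfl⟩
    have hp : Function.Periodic (F t) (2 * π) := hzper t ht
    obtain ⟨y, hy, e⟩ := hp.exists_mem_Ico₀ (by positivity) ξ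
    exact ⟨y, hy, e.symm⟩
  have hfne : ∀ t ∈ Ico 0 T, (frontier (Ω t)).Nonempty := by
    intro t ht; rw [hrange t ht]; exact range_nonempty _
  have hfbd : ∀ t ∈ Ico 0 T, Bornology.IsBounded (frontier (Ω t)) := by
    intro t ht
    rw [hrange t ht]
    refine (Metric.isBounded_closedBall (x := (0 : R2)) (r := M)).subset ?_
    rintro _ ⟨ξ, rfl⟩
    rw [mem_closedBall_zero_iff]
    exact (hGC t ht).bd ξ
  have hconv : ∀ t ∈ Ico 0 T, ∀ ε > 0, ∀ᶠ τ in 𝓝[Ico 0 T] t, ∀ ξ, ∃ ζ, ‖F τ ξ - F t ζ‖ < ε := by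
    intro t ht ε hε
    filter_upwards [(hHaus t ht).eventually (gt_mem_nhds hε), self_mem_nhdsWithin] with τ h1 h2 ξ
    obtain ⟨y, hy, hd⟩ := Metric.exists_dist_lt_of_hausdorffDist_lt
      (show F τ ξ ∈ frontier (Ω τ) by rw [hrange τ h2]; exact mem_range_self _) h1
      (Metric.hausdorffEDist_ne_top_of_nonempty_of_bounded (hfne τ h2) (hfne t ht) (hfbd τ h2) (hfbd t ht))
    rw [hrange t ht] at hy
    obtain ⟨ζ, rfl⟩ := hy
    exact ⟨ζ, by rw [← dist_eq_norm]; exact hd⟩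
  have hlsc : LowerSemicontinuousOn m (Ico 0 T) := by
    intro t ht c hc
    rw [hmm] at hc
    have := mF_lsc (𝓝[Ico 0 T] t) F hγ hM'0 hMp hδπ
      (eventually_of_mem self_mem_nhdsWithin hGC) (hGC t ht) (hconv t ht) hc
    filter_upwards [this] with τ hτ
    rw [hmm]; exact hτ
  have hpos : ∀ t ∈ Ico 0 T, 0 < m t := fun t ht => by rw [hmm]; exact mF_pos (hGC t ht) hδ0 hδπ
  obtain ⟨K, ε₀, hK, hε₀, hgeom⟩ := geom cα hα0 hα hγ1 hMp hM'0 hδ0 hδγ hR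
  refine final_real ht₀.1 ht₀.2 hK hε₀ hpos hlsc ?_
  intro t ht hsm ε hε
  have htI : t ∈ Ico 0 T := ⟨ht₀.1.trans ht.1.le, ht.2⟩
  have ht0 : 0 < t := ht₀.1.trans_lt ht.1
  obtain ⟨ξ, -, η, -, hd, hmin⟩ := mF_att (hGC t htI) hδπ
  obtain ⟨hd2, hvel⟩ := hgeom (Ω t) (F t) (hGC t htI) (hopen t htI) (hbdd t htI) (hrange t htI).subset
    ξ η hd hmin (by rw [← hmm]; exact hpos t htI) (by rw [← hmm]; exact hsm)
    (hsimple t ⟨ht.1.le, ht.2⟩ ξ η hd (by rw [hmm]; exact hmin))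
  have hback : ∀ᶠ h in 𝓝[>] (0 : ℝ), t - h ∈ Ico 0 T := by
    have e1 : ∀ᶠ h in 𝓝[>] (0 : ℝ), h < t := nhdsWithin_le_nhds (gt_mem_nhds ht0)
    filter_upwards [e1, self_mem_nhdsWithin] with h h1 h2
    have h2 : 0 < h := h2
    exact ⟨by linarith, by linarith [ht.2]⟩
  have hT1 : Tendsto (fun h : ℝ => t - h) (𝓝[>] (0 : ℝ)) (𝓝[Ico 0 T] t) := by
    refine tendsto_nhdsWithin_iff.2 ⟨?_, hback⟩
    have : Tendsto (fun h : ℝ => t - h) (𝓝 0) (𝓝 (t - 0)) := (by fun_prop : Continuous fun h : ℝ => t - h).tendsto 0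
    rw [sub_zero] at this
    exact this.mono_left nhdsWithin_le_nhds
  have hT2 : Tendsto (fun h : ℝ => -h) (𝓝[>] (0 : ℝ)) (𝓝[{h : ℝ | t + h ∈ Ico 0 T ∧ h ≠ 0}] 0) := by
    refine tendsto_nhdsWithin_iff.2 ⟨?_, ?_⟩
    · have : Tendsto (fun h : ℝ => -h) (𝓝 0) (𝓝 (-0)) := continuous_neg.tendsto 0
      rw [neg_zero] at this
      exact this.mono_left nhdsWithin_le_nhds
    · filter_upwards [hback, self_mem_nhdsWithin] with h h1 h2
      have h2 : 0 < h := h2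
      exact ⟨by rw [← sub_eq_add_neg]; exact h1, by simpa using h2.ne'⟩
  have hpt := (hpatch t ⟨ht0, ht.2⟩).comp hT2
  obtain ⟨B, hB⟩ := vel_bdd (cα := cα) hα0 hα (hfbd t htI) (hbdd t htI) (hopen t htI).measurableSet
  have hp : ∀ ξ, ∀ ε > 0, ∀ᶠ h in 𝓝[>] (0 : ℝ), ∃ ζ,
      ‖F (t - h) ζ - (F t ξ - h • gSQGvel α cα (Ω t) (F t ξ))‖ ≤ ε * h := by
    intro ξ ε hε
    filter_upwards [hpt.eventually (gt_mem_nhds hε), hback, self_mem_nhdsWithin] with h h1 h2 h3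
    have h3 : 0 < h := h3
    simp only [Function.comp, abs_neg, abs_of_pos h3, ← sub_eq_add_neg] at h1
    rw [div_lt_iff₀ h3] at h1
    have hx : F t ξ ∈ frontier (Ω t) := by rw [hrange t htI]; exact mem_range_self _
    obtain ⟨y, hy, hyd⟩ := Metric.exists_dist_lt_of_hausdorffDist_lt' (mem_image_of_mem _ hx) h1
      (Metric.hausdorffEDist_ne_top_of_nonempty_of_bounded (hfne _ h2) ((hfne t htI).image _)
        (hfbd _ h2) (by
          obtain ⟨B1, hB1⟩ := (hfbd t htI).subset_closedBall 0
          refine (Metric.isBounded_closedBall (x := (0 : R2)) (r := B1 + h * B)).subset ?_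
          rintro _ ⟨x, hx, rfl⟩
          rw [mem_closedBall_zero_iff]
          refine (norm_add_le _ _).trans (add_le_add (mem_closedBall_zero_iff.1 (hB1 hx)) ?_)
          rw [norm_smul, norm_neg, Real.norm_eq_abs, abs_of_pos h3]
          gcongr
          exact hB x hx))
    rw [hrange _ h2] at hy
    obtain ⟨ζ, rfl⟩ := hy
    refine ⟨ζ, ?_⟩
    rw [dist_eq_norm, neg_smul, ← sub_eq_add_neg] at hyd
    exact hyd.le
  have hfin := dini (fun h => F (t - h)) hγ hM'0 hMp (hback.mono fun h hh => hGC _ hh) (hGC t htI)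
    (fun ε hε => hT1.eventually (hconv t htI ε hε)) (gSQGvel α cα (Ω t)) hp
    (by rw [← hmm]; exact hpos t htI) hK hd2 hmin hvel hε
  simp_rw [hmm]
  exact hfin

end
end

section
/- (Lemma 2.2) There exist constants B, R > 0, depending only on γ, M, M', such that for any ξ, η ∈ ℝ with |z(ξ) − z(η)| ≤ R, the angle θ between the tangent vectors z'(ξ) and z'(η) satisfies |tan θ| ≤ B |z(ξ) − z(η)|^{γ/(1+γ)}; equivalently, |z'(ξ)₁ z'(η)₂ − z'(ξ)₂ z'(η)₁| ≤ B |z(ξ) − z(η)|^{γ/(1+γ)} · |z'(ξ)·z'(η)|, and in particular z'(ξ)·z'(η) ≠ 0. -/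
open Real Set

noncomputable section

/-- The Euclidean dot product on the plane. -/
def dot (x y : R2) : ℝ := x 0 * y 0 + x 1 * y 1

/-- The cross (wedge) product of two plane vectors. -/
def cross (x y : R2) : ℝ := x 0 * y 1 - x 1 * y 0

lemma aux_lin (z : ℝ → R2) (M γ r x : ℝ) (hγ0 : 0 < γ) (hM : 0 < M) (hz : ContDiff ℝ 1 z)
    (hH : ∀ ξ η : ℝ, ‖deriv z ξ - deriv z η‖ ≤ M * |ξ - η| ^ γ)
    (s t : ℝ) (hs : |s| ≤ r) (ht : |t| ≤ r) :
    ‖z (x + s) - z (x + t) - (s - t) • deriv z x‖ ≤ M * r ^ γ * |s - t| := by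
  have hd : ∀ u ∈ Icc (-r) r, HasDerivWithinAt (fun u => z (x + u) - u • deriv z x)
      (deriv z (x + u) - deriv z x) (Icc (-r) r) u := by
    intro u _
    have h1 : HasDerivAt z (deriv z (x + u)) (x + u) :=
      (hz.differentiable (by norm_num)).differentiableAt.hasDerivAt
    have h2 := h1.comp_const_add x u
    have h3 : HasDerivAt (fun u : ℝ => u • deriv z x) ((1 : ℝ) • deriv z x) u :=
      (hasDerivAt_id u).smul_const _
    rw [one_smul] at h3
    exact (h2.sub h3).hasDerivWithinAt
  have hb : ∀ u ∈ Icc (-r) r, ‖deriv z (x + u) - deriv z x‖ ≤ M * r ^ γ := by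
    intro u hu
    refine (hH _ _).trans ?_
    have : |x + u - x| ≤ r := by
      rw [add_sub_cancel_left]; exact abs_le.2 hu
    gcongr
  have := Convex.norm_image_sub_le_of_norm_hasDerivWithin_le hd hb (convex_Icc _ _)
    (abs_le.1 ht) (abs_le.1 hs)
  rw [Real.norm_eq_abs] at this
  have e : z (x + s) - z (x + t) - (s - t) • deriv z x =
      (z (x + s) - s • deriv z x) - (z (x + t) - t • deriv z x) := by
    rw [sub_smul]; abel
  rw [e]
  exact this

lemma aux_norm_sq (x : R2) : ‖x‖ ^ 2 = x 0 ^ 2 + x 1 ^ 2 := by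
  rw [EuclideanSpace.norm_sq_eq]; simp [Fin.sum_univ_two]

lemma aux_lagrange (x y : R2) : cross x y ^ 2 + dot x y ^ 2 = ‖x‖ ^ 2 * ‖y‖ ^ 2 := by
  rw [aux_norm_sq, aux_norm_sq]; unfold cross dot; ring

lemma aux_cross_le (x y : R2) : |cross x y| ≤ ‖x‖ * ‖y‖ := by
  apply abs_le_of_sq_le_sq _ (by positivity)
  nlinarith [aux_lagrange x y, sq_nonneg (dot x y)]

lemma aux_inj (z : ℝ → R2) (hp : ∀ ξ : ℝ, z (ξ + 2 * π) = z ξ)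
    (hi : InjOn z (Ico 0 (2 * π))) (x y : ℝ) (h : z x = z y) : deriv z x = deriv z y := by
  have hP : Function.Periodic z (2 * π) := hp
  have hD : Function.Periodic (deriv z) (2 * π) := by
    intro u
    rw [← deriv_comp_add_const]
    congr 1
    funext v
    exact hp v
  have h2 : (0 : ℝ) < 2 * π := by positivity
  have key : toIcoMod h2 0 x = toIcoMod h2 0 y := by
    apply hi
    · simpa using toIcoMod_mem_Ico h2 0 x
    · simpa using toIcoMod_mem_Ico h2 0 y
    · simp only [toIcoMod, hP.sub_zsmul_eq, h]
  have := congrArg (deriv z) key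
  simpa only [toIcoMod, hD.sub_zsmul_eq] using this

lemma aux_zero (z : ℝ → R2) (M γ r ξ η : ℝ) (hγ0 : 0 < γ) (hM : 0 < M) (hz : ContDiff ℝ 1 z)
    (hH : ∀ ξ η : ℝ, ‖deriv z ξ - deriv z η‖ ≤ M * |ξ - η| ^ γ)
    (hB : ∀ ξ : ℝ, ‖deriv z ξ‖ ≤ M) (hr : 0 ≤ r)
    (hc : cross (deriv z ξ) (deriv z η) ≠ 0)
    (hd : ‖z ξ - z η‖ ≤ (|cross (deriv z ξ) (deriv z η)| / M - 2 * M * r ^ γ) * r) :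
    ∃ s t : ℝ, |s| ≤ r ∧ |t| ≤ r ∧ z (ξ + s) = z (η + t) := by
  set a := deriv z ξ with ha
  set b := deriv z η with hb
  set c := cross a b with hcdef
  let A : ℝ × ℝ →L[ℝ] R2 :=
    (ContinuousLinearMap.fst ℝ ℝ ℝ).smulRight a - (ContinuousLinearMap.snd ℝ ℝ ℝ).smulRight b
  have hA : ∀ p : ℝ × ℝ, A p = p.1 • a - p.2 • b := fun p => rfl
  have hcp : 0 < |c| := abs_pos.2 hc
  let S : A.NonlinearRightInverse :=
    { toFun := fun v => (cross v b / c, cross v a / c)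
      nnnorm := ⟨M / |c|, by positivity⟩
      bound' := by
        intro v
        have h1 : ∀ w : R2, ‖w‖ ≤ M → |cross v w / c| ≤ M / |c| * ‖v‖ := by
          intro w hw
          rw [abs_div, div_mul_eq_mul_div]
          gcongr
          exact (aux_cross_le v w).trans (by rw [mul_comm]; gcongr)
        rw [Prod.norm_def]
        exact max_le (h1 b (hB _)) (h1 a (hB _))
      right_inv' := by
        intro v
        rw [hA]
        ext i
        fin_cases i
        · simp
          field_simp
          rw [hcdef]; unfold cross; ring
        · simp
          field_simp
          rw [hcdef]; unfold cross; ring }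
  let F : ℝ × ℝ → R2 := fun p => z (ξ + p.1) - z (η + p.2)
  have happ : ApproximatesLinearOn F A (Metric.closedBall 0 r) ⟨2 * M * r ^ γ, by positivity⟩ := by
    rintro ⟨s, t⟩ h1 ⟨s', t'⟩ h2
    rw [mem_closedBall_zero_iff, Prod.norm_def, max_le_iff] at h1 h2
    have e1 := aux_lin z M γ r ξ hγ0 hM hz hH s s' h1.1 h2.1
    have e2 := aux_lin z M γ r η hγ0 hM hz hH t t' h1.2 h2.2
    have e3 : F (s, t) - F (s', t') - A ((s, t) - (s', t')) =
        (z (ξ + s) - z (ξ + s') - (s - s') • a) - (z (η + t) - z (η + t') - (t - t') • b) := by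
      rw [hA]; simp only [F, Prod.mk_sub_mk]; abel
    rw [e3]
    refine (norm_sub_le _ _).trans ((add_le_add e1 e2).trans ?_)
    have m1 : |s - s'| ≤ ‖(s, t) - (s', t')‖ := norm_fst_le ((s, t) - (s', t'))
    have m2 : |t - t'| ≤ ‖(s, t) - (s', t')‖ := norm_snd_le ((s, t) - (s', t'))
    have m3 : 0 ≤ M * r ^ γ := by positivity
    change _ ≤ 2 * M * r ^ γ * _
    nlinarith [mul_le_mul_of_nonneg_left m1 m3, mul_le_mul_of_nonneg_left m2 m3]
  have hs := happ.surjOn_closedBall_of_nonlinearRightInverse S hr (le_refl _)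
  have h0 : (0 : R2) ∈ Metric.closedBall (F 0) (((S.nnnorm : ℝ)⁻¹ - (⟨2 * M * r ^ γ, by positivity⟩ : NNReal)) * r) := by
    rw [Metric.mem_closedBall, dist_comm, dist_zero_right]
    have : ((S.nnnorm : ℝ))⁻¹ = |c| / M := inv_div _ _
    rw [this]
    simpa [F] using hd
  obtain ⟨⟨s, t⟩, hp, hF⟩ := hs h0
  rw [mem_closedBall_zero_iff, Prod.norm_def, max_le_iff] at hp
  exact ⟨s, t, hp.1, hp.2, sub_eq_zero.1 hF⟩

lemma aux_main (z : ℝ → R2) (M γ ξ η : ℝ) (hγ0 : 0 < γ) (hM : 0 < M) (hz : ContDiff ℝ 1 z)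
    (hp : ∀ ξ : ℝ, z (ξ + 2 * π) = z ξ)
    (hi : InjOn z (Ico 0 (2 * π)))
    (hH : ∀ ξ η : ℝ, ‖deriv z ξ - deriv z η‖ ≤ M * |ξ - η| ^ γ)
    (hB : ∀ ξ : ℝ, ‖deriv z ξ‖ ≤ M) :
    |cross (deriv z ξ) (deriv z η)| ≤
      4 * M ^ 2 * (1 / (2 * M)) ^ (γ / (1 + γ)) * ‖z ξ - z η‖ ^ (γ / (1 + γ)) := by
  by_contra! hcon
  set c := |cross (deriv z ξ) (deriv z η)| with hc
  have hcp : 0 < c := lt_of_le_of_lt (by positivity) hcon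
  set q := c / (4 * M ^ 2) with hq
  have hqp : 0 < q := by positivity
  have hcq : c = 4 * M ^ 2 * q := by rw [hq]; field_simp
  set r := q ^ (1 / γ) with hr
  have hrp : 0 < r := by positivity
  have hrq : r ^ γ = q := by
    rw [hr, ← Real.rpow_mul hqp.le, one_div_mul_cancel hγ0.ne', Real.rpow_one]
  have h1 : (‖z ξ - z η‖ / (2 * M)) ^ (γ / (1 + γ)) < q := by
    rw [div_eq_mul_one_div, Real.mul_rpow (by positivity) (by positivity)]
    rw [hcq] at hcon
    have : 0 < 4 * M ^ 2 := by positivity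
    nlinarith
  have h2 : ‖z ξ - z η‖ / (2 * M) ≤ q * r := by
    have h3 := Real.rpow_le_rpow (by positivity) h1.le (by positivity : 0 ≤ (1 + γ) / γ)
    rw [← Real.rpow_mul (by positivity)] at h3
    have e1 : γ / (1 + γ) * ((1 + γ) / γ) = 1 := by field_simp
    have e2 : (1 + γ) / γ = 1 + 1 / γ := by field_simp; ring
    rw [e1, Real.rpow_one, e2, Real.rpow_add hqp, Real.rpow_one] at h3
    exact h3
  rw [div_le_iff₀ (by positivity)] at h2
  obtain ⟨s, t, hs, ht, hst⟩ := aux_zero z M γ r ξ η hγ0 hM hz hH hB hrp.le (abs_pos.1 hcp) (by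
    rw [← hc, hrq, hcq]
    refine h2.trans (le_of_eq ?_)
    field_simp
    ring)
  have hD := aux_inj z hp hi _ _ hst
  have n1 : ‖deriv z (ξ + s) - deriv z ξ‖ ≤ M * q := by
    refine (hH _ _).trans ?_
    rw [add_sub_cancel_left, ← hrq]; gcongr
  have n2 : ‖deriv z (η + t) - deriv z η‖ ≤ M * q := by
    refine (hH _ _).trans ?_
    rw [add_sub_cancel_left, ← hrq]; gcongr
  have n3 : ‖deriv z η - deriv z ξ‖ ≤ 2 * M * q := by
    have : deriv z η - deriv z ξ =
      (deriv z (ξ + s) - deriv z ξ) - (deriv z (η + t) - deriv z η) := by rw [hD]; abel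
    rw [this]
    exact (norm_sub_le _ _).trans (by linarith)
  have n4 : c ≤ M * (2 * M * q) := by
    have e : cross (deriv z ξ) (deriv z η) = cross (deriv z ξ) (deriv z η - deriv z ξ) := by
      unfold cross; simp; ring
    rw [hc, e]
    refine (aux_cross_le _ _).trans ?_
    gcongr
    exact hB _
  have : 0 < M ^ 2 * q := by positivity
  nlinarith

/-- (Lemma 2.2) Fix `γ ∈ (0,1]` and `M ≥ M' > 0`. There are `B, R > 0`, depending only on
`γ, M, M'`, such that for every simple closed `C¹` curve `z` with `sup|z| + sup|z'| ≤ M`,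
Hölder seminorm of `z'` at most `M`, and `|z'| ≥ M'`, and all `ξ, η` with
`|z(ξ)−z(η)| ≤ R`, the angle `θ` between `z'(ξ)` and `z'(η)` satisfies
`|tan θ| ≤ B|z(ξ)−z(η)|^{γ/(1+γ)}`; i.e.
`|z'(ξ)₁z'(η)₂ − z'(ξ)₂z'(η)₁| ≤ B|z(ξ)−z(η)|^{γ/(1+γ)} |z'(ξ)·z'(η)|`, and in particular
`z'(ξ)·z'(η) ≠ 0`. -/
theorem tangent_angle_lemma (γ M M' : ℝ)
    (hγ0 : 0 < γ) (hγ1 : γ ≤ 1) (hM' : 0 < M') (hMM : M' ≤ M) :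
    ∃ B R : ℝ, 0 < B ∧ 0 < R ∧
      ∀ z : ℝ → R2,
        (∀ ξ : ℝ, z (ξ + 2 * π) = z ξ) →
        InjOn z (Ico 0 (2 * π)) →
        ContDiff ℝ 1 z →
        (∀ ξ η : ℝ, ‖z ξ‖ + ‖deriv z η‖ ≤ M) →
        (∀ ξ η : ℝ, ‖deriv z ξ - deriv z η‖ ≤ M * |ξ - η| ^ γ) →
        (∀ ξ : ℝ, M' ≤ ‖deriv z ξ‖) →
        ∀ ξ η : ℝ, ‖z ξ - z η‖ ≤ R →
          |cross (deriv z ξ) (deriv z η)| ≤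
              B * ‖z ξ - z η‖ ^ (γ / (1 + γ)) * |dot (deriv z ξ) (deriv z η)| ∧
            dot (deriv z ξ) (deriv z η) ≠ 0 := by
  have hM : 0 < M := hM'.trans_le hMM
  set p := γ / (1 + γ) with hp
  have hpp : 0 < p := by positivity
  set C := 4 * M ^ 2 * (1 / (2 * M)) ^ p with hC
  have hCp : 0 < C := by positivity
  refine ⟨2 * C / M' ^ 2, (M' ^ 2 / (2 * C)) ^ (1 / p), by positivity, by positivity, ?_⟩
  intro z hper hinj hz hB hH hL ξ η hR
  have hB' : ∀ ξ, ‖deriv z ξ‖ ≤ M := fun x => by linarith [hB x x, norm_nonneg (z x)]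
  have hm := aux_main z M γ ξ η hγ0 hM hz hper hinj hH hB'
  rw [← hp, ← hC] at hm
  have hRp : ‖z ξ - z η‖ ^ p ≤ M' ^ 2 / (2 * C) := by
    have := Real.rpow_le_rpow (norm_nonneg _) hR hpp.le
    rwa [← Real.rpow_mul (by positivity), one_div_mul_cancel hpp.ne', Real.rpow_one] at this
  have hc2 : |cross (deriv z ξ) (deriv z η)| ≤ M' ^ 2 / 2 := by
    refine hm.trans ((mul_le_mul_of_nonneg_left hRp hCp.le).trans (le_of_eq ?_))
    field_simp
  have hdot : M' ^ 2 / 2 ≤ |dot (deriv z ξ) (deriv z η)| := by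
    refine (pow_le_pow_iff_left₀ (by positivity) (abs_nonneg _) two_ne_zero).1 ?_
    have l := aux_lagrange (deriv z ξ) (deriv z η)
    have l1 : M' ^ 2 * M' ^ 2 ≤ ‖deriv z ξ‖ ^ 2 * ‖deriv z η‖ ^ 2 := by
      gcongr
      · exact hL _
      · exact hL _
    have l2 := pow_le_pow_left₀ (abs_nonneg _) hc2 2
    rw [sq_abs] at l2 ⊢
    nlinarith [sq_nonneg (M' ^ 2)]
  have hM2 : 0 < M' ^ 2 := by positivity
  refine ⟨?_, abs_pos.1 (by linarith)⟩
  refine hm.trans ?_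
  calc C * ‖z ξ - z η‖ ^ p = 2 * C / M' ^ 2 * ‖z ξ - z η‖ ^ p * (M' ^ 2 / 2) := by field_simp
    _ ≤ _ := by gcongr

end
end
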